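/- arXiv:2505.15578 — 11 statements merged into one kernel-verified Lean document; each statement's English description precedes it below -/
import Mathlib

section
/- Let ν > 0 and let a : ℝ → ℝ be continuous on [0,1] and take both a positive and a negative value on [0,1]. Let u and v be C² on [0,1] with u'(0) = u'(1) = v'(0) = v'(1) = 0, and suppose there is δ > 0 with u(x) ≥ δ and v(x) ≥ δ for all x ∈ [0,1]. Assume u is a subsolution, i.e. −ν u''(x) + (1/2) u'(x)² ≤ a(x) u(x) for all x ∈ [0,1], and v is a supersolution, i.e. −ν v''(x) + (1/2) v'(x)² ≥ a(x) v(x) for all x ∈ [0,1]. Then u(x) ≤ v(x) for all x ∈ [0,1], and moreover either u = v on [0,1] or u(x) < v(x) for every x ∈ (0,1). -/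
open Set

/-- `u` is C² on `[0,1]`, with first derivative `u'` and second derivative `u''`. -/
def C2On01 (u u' u'' : ℝ → ℝ) : Prop :=
  (∀ x ∈ Icc (0:ℝ) 1, HasDerivAt u (u' x) x) ∧
  (∀ x ∈ Icc (0:ℝ) 1, HasDerivAt u' (u'' x) x) ∧
  ContinuousOn u'' (Icc (0:ℝ) 1)

/-- A nonnegative solution of `f'' ≤ K (|f'| + f)` with zero initial data vanishes. -/
theorem eq_zero_of_second_deriv_le {f f' f'' : ℝ → ℝ} {c d K : ℝ} (hK : 0 ≤ K)
    (hf : ∀ x ∈ Icc c d, HasDerivAt f (f' x) x)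
    (hf' : ∀ x ∈ Icc c d, HasDerivAt f' (f'' x) x)
    (hpos : ∀ x ∈ Icc c d, 0 ≤ f x) (hc : f c = 0) (hc' : f' c = 0)
    (hle : ∀ x ∈ Icc c d, f'' x ≤ K * (|f' x| + f x)) :
    ∀ x ∈ Icc c d, f x = 0 := by
  have hW : ∀ x ∈ Icc c d, HasDerivAt (fun x => f' x - (K + 1) * f x)
      (f'' x - (K + 1) * f' x) x := fun x hx =>
    (hf' x hx).sub ((hf x hx).const_mul _)
  have hle_zero : ∀ x ∈ Icc c d, f' x - (K + 1) * f x ≤ 0 := by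
    intro x hx
    refine le_of_forall_pos_le_add fun ε hε => ?_
    have hd : 0 < d - c + 1 := by linarith [hx.1.trans hx.2]
    set η := ε / (d - c + 1) with hη
    have hη0 : 0 < η := by positivity
    have hηε : η * (d - c + 1) = ε := by rw [hη]; field_simp
    have key := image_le_of_deriv_right_lt_deriv_boundary (a := c) (b := d)
      (f := fun x => f' x - (K + 1) * f x) (f' := fun x => f'' x - (K + 1) * f' x)
      (B := fun x => η * (x - c + 1)) (B' := fun _ => η)
      (fun t ht => (hW t ht).continuousAt.continuousWithinAt)
      (fun t ht => (hW t (Ico_subset_Icc_self ht)).hasDerivWithinAt)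
      (by simp only [hc, hc']; nlinarith)
      (fun t => by
        simpa using ((((hasDerivAt_id t).sub_const c).add_const 1).const_mul η))
      (fun t ht hWt => by
        have ht' := Ico_subset_Icc_self ht
        have h0 := hpos t ht'
        have h1 := hle t ht'
        have hWpos : 0 < f' t - (K + 1) * f t := by
          rw [hWt]; exact mul_pos hη0 (by linarith [ht.1])
        have hft : 0 ≤ f' t := by nlinarith
        rw [abs_of_nonneg hft] at h1
        nlinarith)
      hx
    have : η * (x - c + 1) ≤ ε := by
      rw [← hηε]; gcongr; exact hx.2
    linarith
  have hanti : AntitoneOn (fun x => f x * Real.exp (-(K + 1) * x)) (Icc c d) := by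
    have hD : ∀ x ∈ Icc c d, HasDerivAt (fun x => f x * Real.exp (-(K + 1) * x))
        ((f' x - (K + 1) * f x) * Real.exp (-(K + 1) * x)) x := fun x hx => by
      refine ((hf x hx).mul (((hasDerivAt_id x).const_mul (-(K + 1))).exp)).congr_deriv ?_
      simp only [id]
      ring
    refine antitoneOn_of_deriv_nonpos (convex_Icc c d)
      (fun x hx => (hD x hx).continuousAt.continuousWithinAt)
      (fun x hx => (hD x (interior_subset hx)).differentiableAt.differentiableWithinAt)
      fun x hx => ?_
    rw [(hD x (interior_subset hx)).deriv]
    exact mul_nonpos_of_nonpos_of_nonneg (hle_zero x (interior_subset hx)) (Real.exp_pos _).le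
  intro x hx
  have h := hanti (left_mem_Icc.2 (hx.1.trans hx.2)) hx hx.1
  simp only [hc, zero_mul] at h
  exact le_antisymm (nonpos_of_mul_nonpos_left h (Real.exp_pos _)) (hpos x hx)

/-- Version of `eq_zero_of_second_deriv_le` with the zero data prescribed at an arbitrary point
of the interval. -/
theorem eq_zero_of_second_deriv_le_of_mem {f f' f'' : ℝ → ℝ} {c d x₀ K : ℝ} (hK : 0 ≤ K)
    (hx₀ : x₀ ∈ Icc c d)
    (hf : ∀ x ∈ Icc c d, HasDerivAt f (f' x) x)
    (hf' : ∀ x ∈ Icc c d, HasDerivAt f' (f'' x) x)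
    (hpos : ∀ x ∈ Icc c d, 0 ≤ f x) (h0 : f x₀ = 0) (h0' : f' x₀ = 0)
    (hle : ∀ x ∈ Icc c d, f'' x ≤ K * (|f' x| + f x)) :
    ∀ x ∈ Icc c d, f x = 0 := by
  intro x hx
  rcases le_total x₀ x with h | h
  · have hs : ∀ t ∈ Icc x₀ d, t ∈ Icc c d := fun t ht => ⟨hx₀.1.trans ht.1, ht.2⟩
    exact eq_zero_of_second_deriv_le hK (fun t ht => hf t (hs t ht)) (fun t ht => hf' t (hs t ht))
      (fun t ht => hpos t (hs t ht)) h0 h0' (fun t ht => hle t (hs t ht)) x ⟨h, hx.2⟩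
  · have hs : ∀ t ∈ Icc (-x₀) (-c), -t ∈ Icc c d := fun t ht =>
      ⟨by linarith [ht.2], by linarith [ht.1, hx₀.2]⟩
    have key := eq_zero_of_second_deriv_le (f := fun t => f (-t)) (f' := fun t => -f' (-t))
      (f'' := fun t => f'' (-t)) (c := -x₀) (d := -c) hK
      (fun t ht =>
        ((hf (-t) (hs t ht)).comp t (hasDerivAt_neg t)).congr_deriv (by ring))
      (fun t ht =>
        ((hf' (-t) (hs t ht)).comp t (hasDerivAt_neg t)).neg.congr_deriv (by ring))
      (fun t ht => hpos _ (hs t ht)) (by simpa using h0) (by simpa using h0')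
      (fun t ht => by simpa using hle _ (hs t ht)) (-x) ⟨by linarith, by linarith [hx.1]⟩
    simpa using key

theorem deriv_eq_zero_of_eqOn_zero_Icc {f f' : ℝ → ℝ} {c d : ℝ} (hcd : c < d)
    (hf : ∀ x ∈ Icc c d, HasDerivAt f (f' x) x) (h0 : ∀ x ∈ Icc c d, f x = 0) :
    ∀ x ∈ Icc c d, f' x = 0 := fun x hx =>
  (uniqueDiffOn_Icc hcd x hx).eq_deriv (Icc c d) (hf x hx).hasDerivWithinAt
    ((hasDerivWithinAt_const x _ 0).congr h0 (h0 x hx))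

/-- Comparison principle (Lemma 3.2): a strictly positive subsolution lies below any strictly
positive supersolution, and either they coincide or the inequality is strict in the interior. -/
theorem stmt_0 (ν : ℝ) (hν : 0 < ν) (a : ℝ → ℝ)
    (ha_cont : ContinuousOn a (Icc (0:ℝ) 1))
    (ha_pos : ∃ x ∈ Icc (0:ℝ) 1, 0 < a x)
    (ha_neg : ∃ x ∈ Icc (0:ℝ) 1, a x < 0)
    (u u' u'' v v' v'' : ℝ → ℝ)
    (hu : C2On01 u u' u'') (hv : C2On01 v v' v'')
    (hu'0 : u' 0 = 0) (hu'1 : u' 1 = 0) (hv'0 : v' 0 = 0) (hv'1 : v' 1 = 0)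
    (δ : ℝ) (hδ : 0 < δ)
    (huδ : ∀ x ∈ Icc (0:ℝ) 1, δ ≤ u x) (hvδ : ∀ x ∈ Icc (0:ℝ) 1, δ ≤ v x)
    (hsub : ∀ x ∈ Icc (0:ℝ) 1, -ν * u'' x + (1/2) * (u' x)^2 ≤ a x * u x)
    (hsup : ∀ x ∈ Icc (0:ℝ) 1, a x * v x ≤ -ν * v'' x + (1/2) * (v' x)^2) :
    (∀ x ∈ Icc (0:ℝ) 1, u x ≤ v x) ∧
      ((∀ x ∈ Icc (0:ℝ) 1, u x = v x) ∨ (∀ x ∈ Ioo (0:ℝ) 1, u x < v x)) := by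
  obtain ⟨hu1, hu2, -⟩ := hu
  obtain ⟨hv1, hv2, -⟩ := hv
  have hu0 : ∀ x ∈ Icc (0:ℝ) 1, 0 < u x := fun x hx => hδ.trans_le (huδ x hx)
  have hv0 : ∀ x ∈ Icc (0:ℝ) 1, 0 < v x := fun x hx => hδ.trans_le (hvδ x hx)
  -- The maximum `R` of `u / v`.
  obtain ⟨x₀, hx₀, hmax⟩ := isCompact_Icc.exists_isMaxOn (nonempty_Icc.2 (zero_le_one' ℝ))
    (f := fun x => u x / v x) (fun x hx => ContinuousAt.continuousWithinAt
      ((hu1 x hx).continuousAt.div (hv1 x hx).continuousAt (hv0 x hx).ne'))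
  obtain ⟨R, hR⟩ : ∃ R, R = u x₀ / v x₀ := ⟨_, rfl⟩
  have huR : ∀ x ∈ Icc (0:ℝ) 1, u x ≤ R * v x := fun x hx => by
    rw [← div_le_iff₀ (hv0 x hx), hR]
    exact hmax hx
  rcases lt_or_ge R 1 with hR1 | hR1
  · have hlt : ∀ x ∈ Icc (0:ℝ) 1, u x < v x := fun x hx => by
      nlinarith [huR x hx, hv0 x hx]
    exact ⟨fun x hx => (hlt x hx).le, Or.inr fun x hx => hlt x (Ioo_subset_Icc_self hx)⟩
  have hy1 : ∀ x ∈ Icc (0:ℝ) 1, HasDerivAt (fun x => R * v x - u x) (R * v' x - u' x) x :=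
    fun x hx => ((hv1 x hx).const_mul R).sub (hu1 x hx)
  have hy2 : ∀ x ∈ Icc (0:ℝ) 1, HasDerivAt (fun x => R * v' x - u' x) (R * v'' x - u'' x) x :=
    fun x hx => ((hv2 x hx).const_mul R).sub (hu2 x hx)
  have hy0 : R * v x₀ - u x₀ = 0 := by
    rw [hR, div_mul_cancel₀ _ (hv0 x₀ hx₀).ne', sub_self]
  have hy0' : R * v' x₀ - u' x₀ = 0 := by
    rcases hx₀.1.eq_or_lt with h | h
    · rw [← h, hu'0, hv'0]; ring
    rcases hx₀.2.eq_or_lt with h' | h'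
    · rw [h', hu'1, hv'1]; ring
    refine IsLocalMin.hasDerivAt_eq_zero ?_ (hy1 x₀ hx₀)
    filter_upwards [Icc_mem_nhds h h'] with x hx
    rw [hy0]
    linarith [huR x hx]
  have hineq : ∀ x ∈ Icc (0:ℝ) 1, ν * (R * v'' x - u'' x) ≤
      R * (1 - R) / 2 * v' x ^ 2 + R * v' x * (R * v' x - u' x) - a x * (R * v x - u x) :=
    fun x hx => by
      nlinarith [hsub x hx, mul_le_mul_of_nonneg_left (hsup x hx) (zero_le_one.trans hR1),
        sq_nonneg (R * v' x - u' x)]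
  obtain ⟨A, hA⟩ := isCompact_Icc.exists_bound_of_continuousOn ha_cont
  obtain ⟨B, hB⟩ := isCompact_Icc.exists_bound_of_continuousOn (f := fun x => R * v' x)
    (fun x hx => ((hv2 x hx).continuousAt.const_mul R).continuousWithinAt)
  simp only [Real.norm_eq_abs] at hA hB
  have hA0 : 0 ≤ A := (abs_nonneg _).trans (hA x₀ hx₀)
  have hB0 : 0 ≤ B := (abs_nonneg _).trans (hB x₀ hx₀)
  have hy : ∀ x ∈ Icc (0:ℝ) 1, R * v x - u x = 0 :=
    eq_zero_of_second_deriv_le_of_mem (K := (A + B) / ν) (by positivity) hx₀ hy1 hy2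
      (fun x hx => sub_nonneg.2 (huR x hx)) hy0 hy0' fun x hx => by
        have hyx := sub_nonneg.2 (huR x hx)
        rw [div_mul_eq_mul_div, le_div_iff₀ hν]
        have h1 : R * v' x * (R * v' x - u' x) ≤ B * |R * v' x - u' x| :=
          (le_abs_self _).trans (by rw [abs_mul]; gcongr; exact hB x hx)
        have h2 : -a x * (R * v x - u x) ≤ A * (R * v x - u x) := by
          gcongr
          exact (neg_le_abs _).trans (hA x hx)
        have h3 : R * (1 - R) / 2 * v' x ^ 2 ≤ 0 :=
          mul_nonpos_of_nonpos_of_nonneg (by nlinarith) (sq_nonneg _)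
        nlinarith [hineq x hx, mul_nonneg hA0 (abs_nonneg (R * v' x - u' x)),
          mul_nonneg hB0 hyx]
  rcases hR1.eq_or_lt with rfl | hR1
  · have heq : ∀ x ∈ Icc (0:ℝ) 1, u x = v x := fun x hx => by linarith [hy x hx]
    exact ⟨fun x hx => (heq x hx).le, Or.inl heq⟩
  -- If `R > 1`, then `u` and `v` are constant and `a ≥ 0`.
  exfalso
  have hy' := deriv_eq_zero_of_eqOn_zero_Icc zero_lt_one hy1 hy
  have hy'' := deriv_eq_zero_of_eqOn_zero_Icc zero_lt_one hy2 hy'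
  have hv'z : ∀ x ∈ Icc (0:ℝ) 1, v' x = 0 := fun x hx => by
    have h := hineq x hx
    rw [hy x hx, hy' x hx, hy'' x hx] at h
    have hneg : R * (1 - R) / 2 < 0 := by nlinarith
    exact pow_eq_zero_iff two_ne_zero |>.1 (by nlinarith [sq_nonneg (v' x)])
  have hv''z := deriv_eq_zero_of_eqOn_zero_Icc zero_lt_one hv2 hv'z
  obtain ⟨x, hx, hax⟩ := ha_neg
  have h := hsub x hx
  have hu''z : u'' x = 0 := by linarith [hy'' x hx, hv''z x hx, mul_eq_zero_of_right R (hv''z x hx)]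
  rw [hu''z] at h
  nlinarith [mul_neg_of_neg_of_pos hax (hu0 x hx), sq_nonneg (u' x)]
end

section
/- Let ν > 0 and let a : ℝ → ℝ be smooth on [0,1] and take both a positive and a negative value on [0,1]. Then there exists a constant C > 0, depending only on ν and a, such that every nonnegative Neumann subsolution u for a satisfies ∫₀¹ u(x) dx ≤ C. -/
open Set

/-- `u` is a nonnegative Neumann subsolution for the coefficient `a`. -/
def NonnegSubsol (ν : ℝ) (a u u' u'' : ℝ → ℝ) : Prop :=
  C2On01 u u' u'' ∧ (∀ x ∈ Icc (0:ℝ) 1, 0 ≤ u x) ∧ u' 0 = 0 ∧ u' 1 = 0 ∧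
  ∀ x ∈ Icc (0:ℝ) 1, -ν * u'' x + (1/2) * (u' x)^2 ≤ a x * u x

/-- The energy of a nonnegative Neumann subsolution is controlled by upper bounds on `a` and `u`. -/
lemma NonnegSubsol.integral_sq_le {ν A P : ℝ} {a u u' u'' : ℝ → ℝ} (hu : NonnegSubsol ν a u u' u'')
    (hA : 0 ≤ A) (ha : ∀ x ∈ Icc (0:ℝ) 1, a x ≤ A) (hP : ∀ x ∈ Icc (0:ℝ) 1, u x ≤ P) :
    ∫ x in (0:ℝ)..1, (u' x) ^ 2 ≤ 2 * A * P := by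
  obtain ⟨⟨-, hu'', hc⟩, h0, hu0, hu1, hle⟩ := hu
  have h01 : uIcc (0:ℝ) 1 = Icc 0 1 := uIcc_of_le zero_le_one
  have hc' : ContinuousOn u' (uIcc 0 1) := fun x hx =>
    (hu'' x (h01 ▸ hx)).continuousAt.continuousWithinAt
  have hi'' : IntervalIntegrable u'' MeasureTheory.volume 0 1 :=
    (h01.symm ▸ hc : ContinuousOn u'' (uIcc 0 1)).intervalIntegrable
  have hzero : ∫ x in (0:ℝ)..1, u'' x = 0 := by
    rw [intervalIntegral.integral_eq_sub_of_hasDerivAt (fun x hx => hu'' x (h01 ▸ hx)) hi'',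
      hu0, hu1, sub_zero]
  calc ∫ x in (0:ℝ)..1, (u' x) ^ 2 ≤ ∫ x in (0:ℝ)..1, (2 * ν * u'' x + 2 * A * P) := by
        refine intervalIntegral.integral_mono_on zero_le_one (hc'.pow 2).intervalIntegrable
          ((hi''.const_mul _).add intervalIntegrable_const) fun x hx => ?_
        have h1 := mul_le_mul_of_nonneg_right (ha x hx) (h0 x hx)
        have h2 := mul_le_mul_of_nonneg_left (hP x hx) hA
        linarith [hle x hx]
    _ = 2 * A * P := by
        rw [intervalIntegral.integral_add (hi''.const_mul _) intervalIntegrable_const,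
          intervalIntegral.integral_const_mul, hzero]
        simp

/-- The squared oscillation of a function on `[0,1]` is at most the energy of its derivative. -/
lemma sq_sub_le_integral_sq_deriv {u u' : ℝ → ℝ} (hu : ∀ x ∈ Icc (0:ℝ) 1, HasDerivAt u (u' x) x)
    (hc : ContinuousOn u' (Icc 0 1)) {x y : ℝ} (hx : x ∈ Icc (0:ℝ) 1) (hy : y ∈ Icc (0:ℝ) 1) :
    (u y - u x) ^ 2 ≤ ∫ t in (0:ℝ)..1, (u' t) ^ 2 := by
  wlog hxy : x ≤ y generalizing x y
  · rw [← neg_sq, neg_sub]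
    exact this hy hx (le_of_not_ge hxy)
  have hsub : uIcc x y ⊆ Icc 0 1 := uIcc_of_le hxy ▸ Icc_subset_Icc hx.1 hy.2
  have hi : IntervalIntegrable u' MeasureTheory.volume x y := (hc.mono hsub).intervalIntegrable
  have hi2 : IntervalIntegrable (fun t => (u' t) ^ 2) MeasureTheory.volume 0 1 :=
    ((hc.pow 2).mono (uIcc_of_le zero_le_one).subset).intervalIntegrable
  set D := u y - u x
  calc D ^ 2 ≤ 2 * D * D - (y - x) * D ^ 2 := by
        nlinarith [mul_nonneg (sq_nonneg D) (by linarith [hx.1, hy.2] : 0 ≤ 1 - (y - x))]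
    _ = ∫ t in x..y, (2 * D * u' t - D ^ 2) := by
        rw [intervalIntegral.integral_sub (hi.const_mul _) intervalIntegrable_const,
          intervalIntegral.integral_const_mul, intervalIntegral.integral_eq_sub_of_hasDerivAt
            (fun t ht => hu t (hsub ht)) hi, intervalIntegral.integral_const, smul_eq_mul]
    _ ≤ ∫ t in x..y, (u' t) ^ 2 :=
        intervalIntegral.integral_mono_on hxy ((hi.const_mul _).sub intervalIntegrable_const)
          ((hc.mono hsub).pow 2).intervalIntegrable
          fun t _ => by nlinarith [sq_nonneg (u' t - D)]
    _ ≤ ∫ t in (0:ℝ)..1, (u' t) ^ 2 :=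
        intervalIntegral.integral_mono_interval hx.1 hxy hy.2
          (Filter.Eventually.of_forall fun t => sq_nonneg (u' t)) hi2

/-- A lower bound on the second derivative bounds the second difference from below. -/
lemma mul_sq_le_second_difference {u u' u'' : ℝ → ℝ} {c d K : ℝ} (hcd : c ≤ d)
    (hu : ∀ x ∈ Icc c d, HasDerivAt u (u' x) x) (hu' : ∀ x ∈ Icc c d, HasDerivAt u' (u'' x) x)
    (hK : ∀ x ∈ Icc c d, K ≤ u'' x) :
    K * ((d - c) / 2) ^ 2 ≤ u c + u d - 2 * u ((c + d) / 2) := by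
  have hconv : ConvexOn ℝ (Icc c d) (fun x => u x - K / 2 * x ^ 2) := by
    refine convexOn_of_hasDerivWithinAt2_nonneg (f' := fun x => u' x - K * x)
      (f'' := fun x => u'' x - K) (convex_Icc c d) ?_ ?_ ?_ ?_
    · intro x hx
      exact ((hu x hx).continuousAt.sub (by fun_prop)).continuousWithinAt
    · intro x hx
      have h := (hu x (interior_subset hx)).sub ((hasDerivAt_pow 2 x).const_mul (K / 2))
      exact (h.congr_deriv (by norm_num; ring)).hasDerivWithinAt
    · intro x hx
      have h := (hu' x (interior_subset hx)).sub ((hasDerivAt_id x).const_mul K)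
      exact (h.congr_deriv (by ring)).hasDerivWithinAt
    · intro x hx
      exact sub_nonneg.2 (hK x (interior_subset hx))
  have h := hconv.2 (left_mem_Icc.2 hcd) (right_mem_Icc.2 hcd)
    (by norm_num : (0:ℝ) ≤ 1 / 2) (by norm_num : (0:ℝ) ≤ 1 / 2) (by norm_num)
  have hmid : (1 / 2 : ℝ) * c + 1 / 2 * d = (c + d) / 2 := by ring
  simp only [smul_eq_mul, hmid] at h
  nlinarith

/-- A function continuous on `[0,1]` with a negative value is bounded above by a negative constant
on a nondegenerate subinterval. -/
lemma exists_Icc_subset_le_neg {a : ℝ → ℝ} (ha : ContinuousOn a (Icc 0 1))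
    (ha_neg : ∃ x ∈ Icc (0:ℝ) 1, a x < 0) :
    ∃ δ > 0, ∃ c d : ℝ, c < d ∧ Icc c d ⊆ Icc 0 1 ∧ ∀ x ∈ Icc c d, a x ≤ -δ := by
  obtain ⟨z, hz, hneg⟩ := ha_neg
  obtain ⟨r, hr, hball⟩ := Metric.continuousWithinAt_iff.1 (ha z hz) (-a z / 2) (by linarith)
  have hbound : ∀ x ∈ Icc (0:ℝ) 1, |x - z| < r → a x ≤ -(-a z / 2) := by
    intro x hx hxz
    have h := hball hx hxz
    rw [Real.dist_eq] at h
    linarith [(abs_lt.1 h).2]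
  have hs : 0 < min r 1 := lt_min hr one_pos
  have hsr := min_le_left r 1
  have hs1 := min_le_right r 1
  refine ⟨-a z / 2, by linarith, ?_⟩
  rcases le_total z (1 / 2) with h | h
  · have hsub : Icc z (z + min r 1 / 2) ⊆ Icc 0 1 := Icc_subset_Icc hz.1 (by linarith)
    refine ⟨z, z + min r 1 / 2, by linarith, hsub, fun x hx => hbound x (hsub hx) ?_⟩
    rw [abs_lt]
    constructor <;> linarith [hx.1, hx.2]
  · have hsub : Icc (z - min r 1 / 2) z ⊆ Icc 0 1 := Icc_subset_Icc (by linarith) hz.2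
    refine ⟨z - min r 1 / 2, z, by linarith, hsub, fun x hx => hbound x (hsub hx) ?_⟩
    rw [abs_lt]
    constructor <;> linarith [hx.1, hx.2]

/-- Uniform `L¹` bound on nonnegative Neumann subsolutions (inside the proof of Lemma 3.3). -/
theorem stmt_2 (ν : ℝ) (hν : 0 < ν) (a : ℝ → ℝ)
    (ha_smooth : ContDiffOn ℝ (⊤ : ℕ∞) a (Icc (0:ℝ) 1))
    (ha_pos : ∃ x ∈ Icc (0:ℝ) 1, 0 < a x)
    (ha_neg : ∃ x ∈ Icc (0:ℝ) 1, a x < 0) :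
    ∃ C > 0, ∀ u u' u'' : ℝ → ℝ, NonnegSubsol ν a u u' u'' →
      ∫ x in (0:ℝ)..1, u x ≤ C := by
  have hac := ha_smooth.continuousOn
  obtain ⟨δ, hδ, c, d, hcd, hsub, hale⟩ := exists_Icc_subset_le_neg hac ha_neg
  have hne : (Icc (0:ℝ) 1).Nonempty := nonempty_Icc.2 zero_le_one
  obtain ⟨w, -, hwmax⟩ := isCompact_Icc.exists_isMaxOn hne hac
  have hA : 0 < a w := by
    obtain ⟨x, hx, hpos⟩ := ha_pos
    exact hpos.trans_le (hwmax hx)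
  set A := a w
  set k := δ / ν * ((d - c) / 2) ^ 2 with hk
  have hk0 : 0 < k := mul_pos (div_pos hδ hν) (pow_pos (by linarith) 2)
  refine ⟨2 * A * (2 / k + 1) ^ 2, by positivity, fun u u' u'' hu => ?_⟩
  have hu_cont : ContinuousOn u (Icc 0 1) := fun x hx =>
    (hu.1.1 x hx).continuousAt.continuousWithinAt
  have hu'_cont : ContinuousOn u' (Icc 0 1) := fun x hx =>
    (hu.1.2.1 x hx).continuousAt.continuousWithinAt
  obtain ⟨y, hy, hmax⟩ := isCompact_Icc.exists_isMaxOn hne hu_cont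
  obtain ⟨x, hx, hmin⟩ := isCompact_Icc.exists_isMinOn hne hu_cont
  have hosc : (u y - u x) ^ 2 ≤ 2 * A * u y :=
    (sq_sub_le_integral_sq_deriv hu.1.1 hu'_cont hx hy).trans
      (hu.integral_sq_le hA.le (fun t ht => hwmax ht) fun t ht => hmax ht)
  have hsd := mul_sq_le_second_difference (K := δ / ν * u x) hcd.le
    (fun t ht => hu.1.1 t (hsub ht)) (fun t ht => hu.1.2.1 t (hsub ht)) fun t ht => by
      have h1 := hu.2.2.2.2 t (hsub ht)
      have h2 := mul_le_mul_of_nonneg_right (hale t ht) (hu.2.1 t (hsub ht))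
      have h3 := mul_le_mul_of_nonneg_left (hmin (hsub ht)) hδ.le
      rw [div_mul_eq_mul_div, div_le_iff₀ hν]
      nlinarith [sq_nonneg (u' t)]
  have hc : u c ≤ u y := hmax (hsub (left_mem_Icc.2 hcd.le))
  have hd : u d ≤ u y := hmax (hsub (right_mem_Icc.2 hcd.le))
  have hm : u x ≤ u ((c + d) / 2) := hmin (hsub ⟨by linarith, by linarith⟩)
  have hxy : u x ≤ u y := hmin hy
  have hux : u x ≤ 2 / k * (u y - u x) := by
    rw [div_mul_eq_mul_div, le_div_iff₀ hk0, mul_comm, hk, mul_right_comm]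
    linarith
  set b := 2 / k + 1 with hb
  have hb0 : 0 < b := by positivity
  have huy : u y ≤ b * (u y - u x) := by
    rw [hb]
    linarith
  have hD : u y - u x ≤ 2 * A * b := by
    rcases hxy.eq_or_lt with h | h
    · rw [h, sub_self]
      positivity
    · refine le_of_mul_le_mul_right ?_ (sub_pos.2 h)
      nlinarith [mul_le_mul_of_nonneg_left huy hA.le]
  calc ∫ t in (0:ℝ)..1, u t ≤ ∫ _ in (0:ℝ)..1, u y :=
        intervalIntegral.integral_mono_on zero_le_one
          (hu_cont.mono (uIcc_of_le zero_le_one).subset).intervalIntegrable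
          intervalIntegrable_const fun t ht => hmax ht
    _ = u y := by simp
    _ ≤ b * (u y - u x) := huy
    _ ≤ b * (2 * A * b) := mul_le_mul_of_nonneg_left hD hb0.le
    _ = 2 * A * b ^ 2 := by ring
end

section
/- Let ν > 0 and let a : ℝ → ℝ be smooth on [0,1] and take both a positive and a negative value on [0,1]. Then there exists a constant C > 0, depending only on ν and a, such that every nonnegative Neumann subsolution u for a satisfies u(x) ≤ C for all x ∈ [0,1]. -/
open Set

/-- A function that is negative somewhere on `[0,1]` and continuous there is bounded away from zero,
from above, on a nontrivial subinterval. -/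
theorem exists_Icc_le_neg {a : ℝ → ℝ} (ha : ContinuousOn a (Icc (0:ℝ) 1))
    {x₀ : ℝ} (hx₀ : x₀ ∈ Icc (0:ℝ) 1) (hneg : a x₀ < 0) :
    ∃ δ > 0, ∃ c d : ℝ, 0 ≤ c ∧ c < d ∧ d ≤ 1 ∧ ∀ x ∈ Icc c d, a x ≤ -δ := by
  obtain ⟨r, hr, h⟩ := Metric.continuousOn_iff.1 ha x₀ hx₀ (-a x₀ / 2) (by linarith)
  obtain ⟨h0, h1⟩ := hx₀
  refine ⟨-a x₀ / 2, by linarith, max 0 (x₀ - r / 2), min 1 (x₀ + r / 2), le_max_left _ _, ?_,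
    min_le_left _ _, ?_⟩
  · rw [max_lt_iff, lt_min_iff, lt_min_iff]
    refine ⟨⟨?_, ?_⟩, ?_, ?_⟩ <;> linarith
  · rintro x ⟨hxl, hxr⟩
    rw [max_le_iff] at hxl
    rw [le_min_iff] at hxr
    have hd := h x ⟨hxl.1, hxr.1⟩ (by rw [Real.dist_eq, abs_lt]; constructor <;> linarith)
    rw [Real.dist_eq, abs_lt] at hd
    linarith [hd.2]

/-- A nonpositive derivative on `[p,q]` makes a function antitone there. -/
theorem antitoneOn_Icc_of_hasDerivAt_nonpos {f f' : ℝ → ℝ} {p q : ℝ}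
    (hf : ∀ x ∈ Icc p q, HasDerivAt f (f' x) x)
    (hf' : ∀ x ∈ Icc p q, f' x ≤ 0) : AntitoneOn f (Icc p q) := by
  refine antitoneOn_of_hasDerivWithinAt_nonpos (f' := f') (convex_Icc p q)
    (fun x hx => (hf x hx).continuousAt.continuousWithinAt)
    (fun x hx => (hf x (interior_subset hx)).hasDerivWithinAt)
    (fun x hx => hf' x (interior_subset hx))

/-- Increment bound between two critical points, for `u` or `-u` according to the sign `s`. -/
theorem mul_increment_le {ν A M ε : ℝ} {a u u' u'' : ℝ → ℝ} (hε : 0 < ε)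
    (hu : NonnegSubsol ν a u u' u'')
    (hA : ∀ x ∈ Icc (0:ℝ) 1, a x * u x ≤ A * M) (hAM : 0 ≤ A * M) {s : ℝ} (hs : s ^ 2 = 1)
    {p q : ℝ} (hp : p ∈ Icc (0:ℝ) 1) (hq : q ∈ Icc (0:ℝ) 1) (hpq : p ≤ q)
    (hp' : u' p = 0) (hq' : u' q = 0) :
    s * (u q - u p) ≤ 2 * ε * (A * M) + 1 / (4 * ε) := by
  obtain ⟨⟨h1, h2, -⟩, -, -, -, hsub⟩ := hu
  set K := 2 * ε * (A * M) + 1 / (4 * ε) with hK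
  have hK0 : 0 ≤ K := by positivity
  have hanti : AntitoneOn (fun x => s * u x - 2 * ε * ν * u' x - K * x) (Icc 0 1) := by
    refine antitoneOn_Icc_of_hasDerivAt_nonpos
      (f' := fun x => s * u' x - 2 * ε * ν * u'' x - K * 1) (fun x hx => ?_) (fun x hx => ?_)
    · exact (((h1 x hx).const_mul s).sub ((h2 x hx).const_mul (2 * ε * ν))).sub
        ((hasDerivAt_id x).const_mul K)
    · have e1 := mul_le_mul_of_nonneg_left ((hsub x hx).trans (hA x hx))
        (by positivity : 0 ≤ 2 * ε)
      have e2 : s * u' x ≤ ε * u' x ^ 2 + 1 / (4 * ε) := by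
        have : ε * u' x ^ 2 + 1 / (4 * ε) - s * u' x = (2 * ε * u' x - s) ^ 2 / (4 * ε) := by
          field_simp
          linear_combination -hs
        have : 0 ≤ (2 * ε * u' x - s) ^ 2 / (4 * ε) := by positivity
        linarith
      simp only [hK]
      linarith
  have := hanti hp hq hpq
  simp only [hp', hq'] at this
  have : K * (q - p) ≤ K := mul_le_of_le_one_right hK0 (by linarith [hp.1, hq.2])
  linarith

/-- At an extremum on `[0,1]`, the derivative of a function satisfying Neumann conditions vanishes. -/
theorem deriv_eq_zero_of_isExtrOn {u u' : ℝ → ℝ}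
    (h1 : ∀ x ∈ Icc (0:ℝ) 1, HasDerivAt u (u' x) x) (h0' : u' 0 = 0) (h1' : u' 1 = 0)
    {p : ℝ} (hp : p ∈ Icc (0:ℝ) 1) (hext : IsExtrOn u (Icc 0 1) p) : u' p = 0 := by
  rcases eq_or_lt_of_le hp.1 with rfl | hl
  · exact h0'
  rcases eq_or_lt_of_le hp.2 with rfl | hr
  · exact h1'
  exact (hext.isLocalExtr (Icc_mem_nhds hl hr)).hasDerivAt_eq_zero (h1 p hp)

/-- A lower bound on the second derivative gives a lower bound on the second difference. -/
theorem second_difference_ge {u u' u'' : ℝ → ℝ} {c d k : ℝ} (hcd : c ≤ d)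
    (h1 : ∀ x ∈ Icc c d, HasDerivAt u (u' x) x) (h2 : ∀ x ∈ Icc c d, HasDerivAt u' (u'' x) x)
    (hk : ∀ x ∈ Icc c d, k ≤ u'' x) :
    k * (d - c) ^ 2 / 4 ≤ u c + u d - 2 * u ((c + d) / 2) := by
  have hd1 : ∀ x ∈ Icc c d, HasDerivAt (fun x => u x - k / 2 * x ^ 2) (u' x - k * x) x := by
    intro x hx
    refine ((h1 x hx).sub ((hasDerivAt_pow 2 x).const_mul (k / 2))).congr_deriv ?_
    norm_num
    ring
  have hconv : ConvexOn ℝ (Icc c d) (fun x => u x - k / 2 * x ^ 2) := by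
    refine convexOn_of_hasDerivWithinAt2_nonneg (f' := fun x => u' x - k * x)
      (f'' := fun x => u'' x - k * 1) (convex_Icc c d)
      (fun x hx => (hd1 x hx).continuousAt.continuousWithinAt)
      (fun x hx => (hd1 x (interior_subset hx)).hasDerivWithinAt)
      (fun x hx => (((h2 x (interior_subset hx)).sub
        ((hasDerivAt_id x).const_mul k))).hasDerivWithinAt)
      (fun x hx => by linarith [hk x (interior_subset hx)])
  have := hconv.2 (left_mem_Icc.2 hcd) (right_mem_Icc.2 hcd) (by norm_num : (0:ℝ) ≤ 1 / 2)
    (by norm_num : (0:ℝ) ≤ 1 / 2) (by norm_num)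
  simp only [smul_eq_mul] at this
  rw [show 1 / 2 * c + 1 / 2 * d = (c + d) / 2 by ring] at this
  linarith

/-- A priori `L^∞` estimate on nonnegative Neumann subsolutions (Lemma 3.3). -/
theorem stmt_3 (ν : ℝ) (hν : 0 < ν) (a : ℝ → ℝ)
    (ha_smooth : ContDiffOn ℝ (⊤ : ℕ∞) a (Icc (0:ℝ) 1))
    (ha_pos : ∃ x ∈ Icc (0:ℝ) 1, 0 < a x)
    (ha_neg : ∃ x ∈ Icc (0:ℝ) 1, a x < 0) :
    ∃ C > 0, ∀ u u' u'' : ℝ → ℝ, NonnegSubsol ν a u u' u'' →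
      ∀ x ∈ Icc (0:ℝ) 1, u x ≤ C := by
  have ha := ha_smooth.continuousOn
  obtain ⟨x₀, hx₀, hneg⟩ := ha_neg
  obtain ⟨δ, hδ, c, d, hc, hcd, hd, hle⟩ := exists_Icc_le_neg ha hx₀ hneg
  obtain ⟨B, hB⟩ := isCompact_Icc.exists_bound_of_continuousOn ha
  obtain ⟨A, hA, haA⟩ : ∃ A > 0, ∀ x ∈ Icc (0:ℝ) 1, a x ≤ A :=
    ⟨max B 1, by positivity, fun x hx =>
      ((le_abs_self _).trans (hB x hx)).trans (le_max_left _ _)⟩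
  have hdc : 0 < d - c := sub_pos.2 hcd
  obtain ⟨κ, hκ⟩ : ∃ κ, κ = δ * (d - c) ^ 2 / (4 * ν) := ⟨_, rfl⟩
  have hκ0 : 0 < κ := by rw [hκ]; positivity
  obtain ⟨ε, hε⟩ : ∃ ε, ε = κ / (4 * A * (2 + κ)) := ⟨_, rfl⟩
  have hε0 : 0 < ε := by rw [hε]; positivity
  refine ⟨(2 + κ) / (2 * ε * κ), by positivity, fun u u' u'' hu x hx => ?_⟩
  obtain ⟨⟨h1, h2, -⟩, hnn, h0', h1', hsub⟩ := id hu
  have hcont : ContinuousOn u (Icc 0 1) :=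
    fun x hx => (h1 x hx).continuousAt.continuousWithinAt
  obtain ⟨q, hq, hmax⟩ := isCompact_Icc.exists_isMaxOn ⟨x, hx⟩ hcont
  obtain ⟨p, hp, hmin⟩ := isCompact_Icc.exists_isMinOn ⟨x, hx⟩ hcont
  have hq' := deriv_eq_zero_of_isExtrOn h1 h0' h1' hq (Or.inr hmax)
  have hp' := deriv_eq_zero_of_isExtrOn h1 h0' h1' hp (Or.inl hmin)
  have hup : ∀ y ∈ Icc (0:ℝ) 1, u y ≤ u q := fun y hy => hmax hy
  have hlow : ∀ y ∈ Icc (0:ℝ) 1, u p ≤ u y := fun y hy => hmin hy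
  have hAM : 0 ≤ A * u q := mul_nonneg hA.le (hnn q hq)
  have hau : ∀ y ∈ Icc (0:ℝ) 1, a y * u y ≤ A * u q := fun y hy =>
    (mul_le_mul_of_nonneg_right (haA y hy) (hnn y hy)).trans
      (mul_le_mul_of_nonneg_left (hup y hy) hA.le)
  have hosc : u q - u p ≤ 2 * ε * (A * u q) + 1 / (4 * ε) := by
    rcases le_total p q with hpq | hqp
    · have := mul_increment_le hε0 hu hau hAM (s := 1) (by norm_num) hp hq hpq hp' hq'
      linarith
    · have := mul_increment_le hε0 hu hau hAM (s := -1) (by norm_num) hq hp hqp hq' hp'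
      linarith
  have hmem : ∀ y ∈ Icc c d, y ∈ Icc (0:ℝ) 1 := fun y hy => ⟨hc.trans hy.1, hy.2.trans hd⟩
  have hsd := second_difference_ge (k := δ * u p / ν) hcd.le (fun y hy => h1 y (hmem y hy))
    (fun y hy => h2 y (hmem y hy)) (fun y hy => by
      rw [div_le_iff₀ hν]
      have e1 := hsub y (hmem y hy)
      have e2 := mul_le_mul_of_nonneg_right (hle y hy) (hnn y (hmem y hy))
      have e3 := mul_le_mul_of_nonneg_left (hlow y (hmem y hy)) hδ.le
      linarith [sq_nonneg (u' y)])
  have hκp : δ * u p / ν * (d - c) ^ 2 / 4 = κ * u p := by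
    rw [hκ]
    field_simp
  rw [hκp] at hsd
  have e1 := hup c (hmem c ⟨le_rfl, hcd.le⟩)
  have e2 := hup d (hmem d ⟨hcd.le, le_rfl⟩)
  have e3 := hlow ((c + d) / 2) (hmem _ ⟨by linarith, by linarith⟩)
  have hfin : κ * u q ≤ (2 + κ) * (2 * ε * (A * u q) + 1 / (4 * ε)) := by
    have := mul_le_mul_of_nonneg_left hosc (by positivity : 0 ≤ 2 + κ)
    linarith
  have hεκ : (2 + κ) * (2 * ε * (A * u q)) = κ / 2 * u q := by
    rw [hε]
    field_simp
    ring
  rw [mul_add, hεκ] at hfin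
  refine (hup x hx).trans ?_
  have e4 : κ * ((2 + κ) / (2 * ε * κ)) = 2 * ((2 + κ) * (1 / (4 * ε))) := by
    field_simp
    ring
  exact le_of_mul_le_mul_left (by linarith) hκ0
end

section
/- Let ν > 0 and let a : ℝ → ℝ be continuous on [0,1]. Suppose there exist λ > 0 and a C² function φ with φ(x) > 0 for all x ∈ [0,1], φ'(0) = φ'(1) = 0, and −ν φ''(x) − a(x) φ(x) = −λ φ(x) for all x ∈ [0,1]. Then there exists a C² function u₀ on [0,1] and δ > 0 such that u₀(x) ≥ δ for all x ∈ [0,1], u₀'(0) = u₀'(1) = 0, and −ν u₀''(x) + (1/2) u₀'(x)² ≤ a(x) u₀(x) for all x ∈ [0,1]. -/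
open Set

/-- Lemma 3.4: if the principal Neumann eigenvalue of `-ν d²/dx² - a` is negative (witnessed by a
positive eigenfunction `φ` with eigenvalue `-lam`, `lam > 0`), then there exists a strictly
positive smooth Neumann subsolution of `-ν u'' + (1/2)(u')² = a u`. -/
theorem stmt_4 (ν : ℝ) (hν : 0 < ν) (a : ℝ → ℝ)
    (ha_cont : ContinuousOn a (Icc (0:ℝ) 1))
    (lam : ℝ) (hlam : 0 < lam) (φ φ' φ'' : ℝ → ℝ)
    (hφ : C2On01 φ φ' φ'')
    (hφ_pos : ∀ x ∈ Icc (0:ℝ) 1, 0 < φ x)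
    (hφ'0 : φ' 0 = 0) (hφ'1 : φ' 1 = 0)
    (hφ_eq : ∀ x ∈ Icc (0:ℝ) 1, -ν * φ'' x - a x * φ x = -lam * φ x) :
    ∃ (u₀ u₀' u₀'' : ℝ → ℝ) (δ : ℝ), 0 < δ ∧ C2On01 u₀ u₀' u₀'' ∧
      (∀ x ∈ Icc (0:ℝ) 1, δ ≤ u₀ x) ∧ u₀' 0 = 0 ∧ u₀' 1 = 0 ∧
      ∀ x ∈ Icc (0:ℝ) 1, -ν * u₀'' x + (1/2) * (u₀' x)^2 ≤ a x * u₀ x := by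
  obtain ⟨hd, hd', hc⟩ := hφ
  have hne : (Icc (0:ℝ) 1).Nonempty := ⟨0, by simp⟩
  have hcφ : ContinuousOn φ (Icc (0:ℝ) 1) :=
    fun x hx => (hd x hx).continuousAt.continuousWithinAt
  have hcφ' : ContinuousOn φ' (Icc (0:ℝ) 1) :=
    fun x hx => (hd' x hx).continuousAt.continuousWithinAt
  obtain ⟨p, hp, hmin⟩ := isCompact_Icc.exists_isMinOn hne hcφ
  obtain ⟨q, hq, hmax⟩ := isCompact_Icc.exists_isMaxOn hne (hcφ'.pow 2)
  have hm : 0 < φ p := hφ_pos p hp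
  have hM : 0 < φ' q ^ 2 + 1 := by positivity
  obtain ⟨ε, hε, hεM⟩ : ∃ ε : ℝ, 0 < ε ∧ ε * (φ' q ^ 2 + 1) = 2 * lam * φ p :=
    ⟨2 * lam * φ p / (φ' q ^ 2 + 1), by positivity, by field_simp⟩
  refine ⟨fun x => ε * φ x, fun x => ε * φ' x, fun x => ε * φ'' x, ε * φ p, by positivity,
    ⟨fun x hx => (hd x hx).const_mul ε, fun x hx => (hd' x hx).const_mul ε,
      continuousOn_const.mul hc⟩, fun x hx => ?_, by simp [hφ'0], by simp [hφ'1],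
    fun x hx => ?_⟩
  · exact mul_le_mul_of_nonneg_left (hmin hx) hε.le
  · have h1 : φ p ≤ φ x := hmin hx
    have h2 : φ' x ^ 2 ≤ φ' q ^ 2 := hmax hx
    have h3 : ε * φ' x ^ 2 ≤ 2 * lam * φ x :=
      calc ε * φ' x ^ 2 ≤ ε * (φ' q ^ 2 + 1) := by gcongr; linarith
        _ = 2 * lam * φ p := hεM
        _ ≤ 2 * lam * φ x := by gcongr
    have h4 : ε * (ε * φ' x ^ 2) ≤ ε * (2 * lam * φ x) := by gcongr
    linear_combination ε * hφ_eq x hx + h4 / 2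
end

section
/- Let ν > 0 and let a : ℝ → ℝ be smooth on [0,1]. Assume: (i) there exist λ > 0 and a C² function φ with φ(x) > 0 for all x ∈ [0,1], φ'(0) = φ'(1) = 0, and −ν φ''(x) − a(x) φ(x) = −λ φ(x) for all x ∈ [0,1]; and (ii) there exists x₀ ∈ [0,1] with a(x₀) < 0. Then there exists exactly one C² function u on [0,1] such that u(x) > 0 for all x ∈ [0,1], u'(0) = u'(1) = 0, and −ν u''(x) + (1/2) u'(x)² = a(x) u(x) for all x ∈ [0,1]. -/
open Set

/-- `u` is a positive Neumann solution of `-ν u'' + (1/2)(u')² = a u` on `[0,1]`. -/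
def PosSol (ν : ℝ) (a u u' u'' : ℝ → ℝ) : Prop :=
  C2On01 u u' u'' ∧ (∀ x ∈ Icc (0:ℝ) 1, 0 < u x) ∧ u' 0 = 0 ∧ u' 1 = 0 ∧
  ∀ x ∈ Icc (0:ℝ) 1, -ν * u'' x + (1/2) * (u' x)^2 = a x * u x

open scoped NNReal

/-- A family of solutions of `z'' = F(t, z)`, `z(0) = s`, `z'(0) = 0` on `[0,1]`, depending
continuously on `s`. -/
lemma exists_shooting_family {F : ℝ → ℝ → ℝ} {C L : ℝ≥0}
    (hFc : ∀ z, ContinuousOn (F · z) (Icc 0 1))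
    (hFL : ∀ t ∈ Icc (0:ℝ) 1, LipschitzWith L (F t))
    (hFb : ∀ t ∈ Icc (0:ℝ) 1, ∀ z, |F t z| ≤ C) (R : ℝ≥0) :
    ∃ Z P : ℝ → ℝ → ℝ,
      (∀ s ∈ Icc (-R : ℝ) R, Z s 0 = s ∧ P s 0 = 0 ∧
        ∀ t ∈ Icc (0:ℝ) 1, HasDerivAt (Z s) (P s t) t ∧ HasDerivAt (P s) (F t (Z s t)) t) ∧
      ContinuousOn (fun s ↦ P s 1) (Icc (-R : ℝ) R) := by
  let π : ℝ → ℝ := fun t ↦ (projIcc (0:ℝ) 1 zero_le_one t : ℝ)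
  have hπc : Continuous π := continuous_subtype_val.comp continuous_projIcc
  have hπm : ∀ t, π t ∈ Icc (0:ℝ) 1 := fun t ↦ (projIcc (0:ℝ) 1 zero_le_one t).2
  have hπe : ∀ t ∈ Icc (0:ℝ) 1, π t = t := fun t ht ↦ by simp [π, projIcc_of_mem _ ht]
  let v : ℝ → ℝ × ℝ → ℝ × ℝ := fun t y ↦ (max (-C) (min y.2 C), F (π t) y.1)
  have hC : (0:ℝ) ≤ C := C.2
  have hpl : IsPicardLindelof v (tmin := -1) (tmax := 2) ⟨0, by norm_num⟩ (0 : ℝ × ℝ)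
      (C * 2 + R) R C (max 1 L) := by
    refine ⟨fun t _ ↦ ?_, fun y _ ↦ ?_, fun t _ y _ ↦ ?_, ?_⟩
    · refine (LipschitzWith.prodMk (Kg := L) ?_ ?_).lipschitzOnWith
      · have h : LipschitzWith 1 (fun y : ℝ × ℝ ↦ y.2) := LipschitzWith.prod_snd
        exact (h.min_const (C : ℝ)).const_max _
      · have h : LipschitzWith (L * 1) (fun y : ℝ × ℝ ↦ F (π t) y.1) :=
          (hFL _ (hπm t)).comp LipschitzWith.prod_fst
        rwa [mul_one] at h
    · exact (continuous_const.prodMk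
        ((hFc y.1).comp_continuous hπc hπm)).continuousOn
    · refine max_le ?_ (by simpa using hFb _ (hπm t) y.1)
      rw [Real.norm_eq_abs, abs_le]
      exact ⟨le_max_left _ _, max_le (by linarith) (min_le_right _ _)⟩
    · norm_num
  obtain ⟨α, hα, L', hL'⟩ :=
    hpl.exists_forall_mem_closedBall_eq_hasDerivWithinAt_lipschitzOnWith
  have hmem : ∀ s ∈ Icc (-R : ℝ) R, ((s, 0) : ℝ × ℝ) ∈ Metric.closedBall (0 : ℝ × ℝ) R := by
    intro s hs
    simpa [Prod.norm_def, abs_le] using hs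
  refine ⟨fun s t ↦ (α (s, 0) t).1, fun s t ↦ (α (s, 0) t).2, fun s hs ↦ ?_, ?_⟩
  · obtain ⟨h0, hd⟩ := hα _ (hmem s hs)
    have h0 : α (s, 0) 0 = (s, 0) := h0
    have hd' : ∀ t ∈ Icc (0:ℝ) 1, HasDerivAt (α (s, 0)) (v t (α (s, 0) t)) t := fun t ht ↦
      (hd t ⟨by linarith [ht.1], by linarith [ht.2]⟩).hasDerivAt
        (Icc_mem_nhds (by linarith [ht.1]) (by linarith [ht.2]))
    have h2 : ∀ t ∈ Icc (0:ℝ) 1,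
        HasDerivAt (fun t ↦ (α (s, 0) t).2) (F t (α (s, 0) t).1) t := fun t ht ↦ by
      have : HasDerivAt (fun t ↦ (α (s, 0) t).2) (v t (α (s, 0) t)).2 t :=
        (ContinuousLinearMap.snd ℝ ℝ ℝ).hasFDerivAt.comp_hasDerivAt t (hd' t ht)
      simpa only [v, hπe t ht] using this
    refine ⟨by simp [h0], by simp [h0], fun t ht ↦ ⟨?_, h2 t ht⟩⟩
    have hb : |(α (s, 0) t).2| ≤ C := by
      have := norm_image_sub_le_of_norm_deriv_le_segment' (C := C)
        (fun x hx ↦ (h2 x hx).hasDerivWithinAt)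
        (fun x hx ↦ hFb x ⟨hx.1, hx.2.le⟩ _) t ht
      simp only [h0, sub_zero, Real.norm_eq_abs] at this
      nlinarith [ht.2]
    have : HasDerivAt (fun t ↦ (α (s, 0) t).1) (v t (α (s, 0) t)).1 t :=
      (ContinuousLinearMap.fst ℝ ℝ ℝ).hasFDerivAt.comp_hasDerivAt t (hd' t ht)
    rw [abs_le] at hb
    simpa only [v, min_eq_left hb.2, max_eq_right hb.1] using this
  · have := (hL' 1 ⟨by norm_num, by norm_num⟩).continuousOn
    exact continuous_snd.comp_continuousOn
      (this.comp (f := fun s : ℝ ↦ ((s, 0) : ℝ × ℝ)) (by fun_prop) fun s hs ↦ hmem s hs)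

/-- A function that is strictly concave where negative and starts negative and nonincreasing
keeps decreasing. -/
lemma deriv_neg_of_concave_where_neg {y y' y'' : ℝ → ℝ}
    (hy : ∀ x ∈ Icc (0:ℝ) 1, HasDerivAt y (y' x) x)
    (hy' : ∀ x ∈ Icc (0:ℝ) 1, HasDerivAt y' (y'' x) x)
    (hneg : ∀ x ∈ Icc (0:ℝ) 1, y x < 0 → y'' x < 0)
    {c : ℝ} (hc0 : 0 ≤ c) (hc1 : c < 1) (hyc : y c < 0) (hyc' : y' c ≤ 0) : y' 1 < 0 := by
  have hsub : Icc c 1 ⊆ Icc (0:ℝ) 1 := Icc_subset_Icc_left hc0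
  have hyC : ContinuousOn y (Icc c 1) := fun x hx ↦
    (hy x (hsub hx)).continuousAt.continuousWithinAt
  have hyC' : ContinuousOn y' (Icc c 1) := fun x hx ↦
    (hy' x (hsub hx)).continuousAt.continuousWithinAt
  have key : ∀ T ∈ Icc c 1, (∀ x ∈ Ico c T, y x < 0) → StrictAntiOn y' (Icc c T) := by
    intro T hT hlt
    refine strictAntiOn_of_deriv_neg (convex_Icc _ _)
      (hyC'.mono (Icc_subset_Icc_right hT.2)) fun x hx ↦ ?_
    rw [interior_Icc] at hx
    have hx' : x ∈ Icc (0:ℝ) 1 := ⟨hc0.trans hx.1.le, hx.2.le.trans hT.2⟩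
    rw [(hy' x hx').deriv]
    exact hneg x hx' (hlt x ⟨hx.1.le, hx.2⟩)
  by_cases hall : ∀ x ∈ Icc c 1, y x < 0
  · have := key 1 ⟨hc1.le, le_rfl⟩ (fun x hx ↦ hall x ⟨hx.1, hx.2.le⟩)
      ⟨le_rfl, hc1.le⟩ ⟨hc1.le, le_rfl⟩ hc1
    linarith
  · exfalso
    push Not at hall
    obtain ⟨x₁, hx₁, hyx₁⟩ := hall
    have hcomp : IsCompact (Icc c 1 ∩ y ⁻¹' Ici 0) :=
      isCompact_Icc.of_isClosed_subset (hyC.preimage_isClosed_of_isClosed isClosed_Icc isClosed_Ici)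
        inter_subset_left
    obtain ⟨T, ⟨hT, hyT⟩, hTmin⟩ := hcomp.exists_isLeast ⟨x₁, hx₁, hyx₁⟩
    have hlt : ∀ x ∈ Ico c T, y x < 0 := by
      intro x hx
      by_contra! h
      exact absurd (hTmin ⟨⟨hx.1, hx.2.le.trans hT.2⟩, h⟩) (not_le.2 hx.2)
    have hanti := (key T hT hlt).antitoneOn
    have : AntitoneOn y (Icc c T) := by
      refine antitoneOn_of_deriv_nonpos (convex_Icc _ _) (hyC.mono (Icc_subset_Icc_right hT.2))
        (fun x hx ↦ ?_) fun x hx ↦ ?_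
      all_goals
        rw [interior_Icc] at hx
        have hx' : x ∈ Icc (0:ℝ) 1 := ⟨hc0.trans hx.1.le, hx.2.le.trans hT.2⟩
      · exact (hy x hx').differentiableAt.differentiableWithinAt
      · rw [(hy x hx').deriv]
        exact (hanti ⟨le_rfl, hT.1⟩ ⟨hx.1.le, hx.2.le⟩ hx.1.le).trans hyc'
    have h1 := this ⟨le_rfl, hT.1⟩ ⟨hT.1, le_rfl⟩ hT.1
    have h2 : 0 ≤ y T := hyT
    linarith

/-- A maximum principle with Neumann boundary conditions. -/
lemma nonneg_of_concave_where_neg {y y' y'' : ℝ → ℝ}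
    (hy : ∀ x ∈ Icc (0:ℝ) 1, HasDerivAt y (y' x) x)
    (hy' : ∀ x ∈ Icc (0:ℝ) 1, HasDerivAt y' (y'' x) x)
    (hneg : ∀ x ∈ Icc (0:ℝ) 1, y x < 0 → y'' x < 0)
    (h0 : y' 0 ≤ 0) (h1 : 0 ≤ y' 1) : ∀ x ∈ Icc (0:ℝ) 1, 0 ≤ y x := by
  have hyC : ContinuousOn y (Icc 0 1) := fun x hx ↦
    (hy x hx).continuousAt.continuousWithinAt
  obtain ⟨c, hc, hmin⟩ := isCompact_Icc.exists_isMinOn (nonempty_Icc.2 zero_le_one) hyC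
  intro x hx
  by_contra! hlt
  have hyc : y c < 0 := (hmin hx).trans_lt hlt
  rcases hc.2.eq_or_lt with rfl | hc1
  · have hr : ∀ x ∈ Icc (0:ℝ) 1, 1 - x ∈ Icc (0:ℝ) 1 := fun x hx ↦
      ⟨by linarith [hx.2], by linarith [hx.1]⟩
    have := deriv_neg_of_concave_where_neg (y := fun x ↦ y (1 - x)) (y' := fun x ↦ -y' (1 - x))
      (y'' := fun x ↦ y'' (1 - x))
      (fun x hx ↦ by simpa using (hy _ (hr x hx)).comp_const_sub 1 x)
      (fun x hx ↦ by
        have := ((hy' _ (hr x hx)).comp_const_sub 1 x).fun_neg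
        rwa [neg_neg] at this)
      (fun x hx ↦ hneg _ (hr x hx)) le_rfl one_pos (by simpa using hyc) (by simpa using h1)
    simp at this
    linarith
  · refine absurd (deriv_neg_of_concave_where_neg hy hy' hneg hc.1 hc1 hyc ?_) (not_lt.2 h1)
    rcases hc.1.eq_or_lt with rfl | hc0
    · exact h0
    · exact ((hmin.isLocalMin (Icc_mem_nhds hc0 hc1)).hasDerivAt_eq_zero (hy c hc)).le

/-- The method of sub- and supersolutions for the Neumann problem `z'' = f(t, z)`. -/
lemma exists_neumann_solution_between {f : ℝ → ℝ → ℝ} {C L : ℝ≥0}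
    (hfc : ∀ z, ContinuousOn (f · z) (Icc 0 1))
    (hfL : ∀ t ∈ Icc (0:ℝ) 1, LipschitzWith L (f t))
    (hfb : ∀ t ∈ Icc (0:ℝ) 1, ∀ z, |f t z| ≤ C)
    {A A' A'' B B' B'' : ℝ → ℝ}
    (hA : ∀ x ∈ Icc (0:ℝ) 1, HasDerivAt A (A' x) x)
    (hA' : ∀ x ∈ Icc (0:ℝ) 1, HasDerivAt A' (A'' x) x)
    (hB : ∀ x ∈ Icc (0:ℝ) 1, HasDerivAt B (B' x) x)
    (hB' : ∀ x ∈ Icc (0:ℝ) 1, HasDerivAt B' (B'' x) x)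
    (hAB : ∀ x ∈ Icc (0:ℝ) 1, A x ≤ B x)
    (hAf : ∀ x ∈ Icc (0:ℝ) 1, f x (A x) ≤ A'' x)
    (hBf : ∀ x ∈ Icc (0:ℝ) 1, B'' x ≤ f x (B x))
    (hA0 : 0 ≤ A' 0) (hA1 : A' 1 ≤ 0) (hB0 : B' 0 ≤ 0) (hB1 : 0 ≤ B' 1) :
    ∃ z p : ℝ → ℝ, (∀ x ∈ Icc (0:ℝ) 1, HasDerivAt z (p x) x) ∧
      (∀ x ∈ Icc (0:ℝ) 1, HasDerivAt p (f x (z x)) x) ∧ p 0 = 0 ∧ p 1 = 0 ∧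
      ∀ x ∈ Icc (0:ℝ) 1, A x ≤ z x ∧ z x ≤ B x := by
  have hAc : ContinuousOn A (Icc 0 1) := fun x hx ↦ (hA x hx).continuousAt.continuousWithinAt
  have hBc : ContinuousOn B (Icc 0 1) := fun x hx ↦ (hB x hx).continuousAt.continuousWithinAt
  let c : ℝ → ℝ → ℝ := fun t z ↦ max (A t) (min z (B t))
  let F : ℝ → ℝ → ℝ := fun t z ↦ f t (c t z) + max (-1) (min (z - c t z) 1)
  have hcL : ∀ t, LipschitzWith 1 (c t) := fun t ↦
    (LipschitzWith.id.min_const (B t)).const_max (A t)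
  have hcc : ∀ z, ContinuousOn (c · z) (Icc 0 1) := fun z ↦
    hAc.sup (continuousOn_const.inf hBc)
  have hfu : ContinuousOn (Function.uncurry f) (Icc 0 1 ×ˢ univ) :=
    continuousOn_prod_of_continuousOn_lipschitzOnWith' _ L
      (fun t ht ↦ (hfL t ht).lipschitzOnWith) fun z _ ↦ hfc z
  have hFc : ∀ z, ContinuousOn (F · z) (Icc 0 1) := fun z ↦
    (hfu.comp (continuousOn_id.prodMk (hcc z)) fun t ht ↦ ⟨ht, mem_univ _⟩).add
      (continuousOn_const.sup ((continuousOn_const.sub (hcc z)).inf continuousOn_const))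
  have hFL : ∀ t ∈ Icc (0:ℝ) 1, LipschitzWith (L * 1 + (1 + 1)) (F t) := fun t ht ↦
    ((hfL t ht).comp (hcL t)).add (((LipschitzWith.id.sub (hcL t)).min_const 1).const_max (-1))
  have hFb : ∀ t ∈ Icc (0:ℝ) 1, ∀ z, |F t z| ≤ (C + 1 : ℝ≥0) := fun t ht z ↦ by
    push_cast
    refine (abs_add_le _ _).trans (add_le_add (hfb t ht _) (abs_le.2 ⟨le_max_left _ _, ?_⟩))
    exact max_le (by norm_num) (min_le_right _ _)
  have hFA : ∀ t ∈ Icc (0:ℝ) 1, ∀ z, z < A t → F t z < A'' t := fun t ht z hz ↦ by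
    have hct : c t z = A t := max_eq_left ((min_le_left _ _).trans hz.le)
    have : max (-1) (min (z - A t) 1) < 0 :=
      max_lt (by norm_num) ((min_le_left _ _).trans_lt (by linarith))
    simp only [F, hct]
    linarith [hAf t ht]
  have hFB : ∀ t ∈ Icc (0:ℝ) 1, ∀ z, B t < z → B'' t < F t z := fun t ht z hz ↦ by
    have hct : c t z = B t := by simp only [c, min_eq_right hz.le, max_eq_right (hAB t ht)]
    have : 0 < max (-1) (min (z - B t) 1) :=
      lt_max_of_lt_right (lt_min (by linarith) one_pos)
    simp only [F, hct]
    linarith [hBf t ht]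
  have m0 : (0:ℝ) ∈ Icc (0:ℝ) 1 := ⟨le_rfl, zero_le_one⟩
  let R : ℝ≥0 := ‖A 0‖₊ + ‖B 0‖₊ + 1
  have hR : (R : ℝ) = |A 0| + |B 0| + 1 := by simp [R]
  obtain ⟨Z, P, hZP, hPc⟩ := exists_shooting_family hFc hFL hFb R
  have hsub : Icc (A 0 - 1) (B 0 + 1) ⊆ Icc (-R : ℝ) R := by
    apply Icc_subset_Icc <;> rw [hR] <;>
      linarith [neg_abs_le (A 0), abs_nonneg (A 0), abs_nonneg (B 0), le_abs_self (B 0)]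
  have hle : A 0 - 1 ≤ B 0 + 1 := by linarith [hAB 0 m0]
  have below : ∀ s ∈ Icc (-R : ℝ) R, ∀ x ∈ Icc (0:ℝ) 1,
      HasDerivAt (fun x ↦ Z s x - A x) (P s x - A' x) x ∧
      HasDerivAt (fun x ↦ P s x - A' x) (F x (Z s x) - A'' x) x ∧
      (Z s x - A x < 0 → F x (Z s x) - A'' x < 0) := fun s hs x hx ↦
    ⟨((hZP s hs).2.2 x hx).1.sub (hA x hx), ((hZP s hs).2.2 x hx).2.sub (hA' x hx),
      fun h ↦ sub_neg.2 (hFA x hx _ (sub_neg.1 h))⟩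
  have above : ∀ s ∈ Icc (-R : ℝ) R, ∀ x ∈ Icc (0:ℝ) 1,
      HasDerivAt (fun x ↦ B x - Z s x) (B' x - P s x) x ∧
      HasDerivAt (fun x ↦ B' x - P s x) (B'' x - F x (Z s x)) x ∧
      (B x - Z s x < 0 → B'' x - F x (Z s x) < 0) := fun s hs x hx ↦
    ⟨(hB x hx).sub ((hZP s hs).2.2 x hx).1, (hB' x hx).sub ((hZP s hs).2.2 x hx).2,
      fun h ↦ sub_neg.2 (hFB x hx _ (sub_neg.1 h))⟩
  have hlow : P (A 0 - 1) 1 ≤ 0 := by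
    have hs := hsub ⟨le_rfl, hle⟩
    have := deriv_neg_of_concave_where_neg (fun x hx ↦ (below _ hs x hx).1)
      (fun x hx ↦ (below _ hs x hx).2.1) (fun x hx ↦ (below _ hs x hx).2.2) le_rfl one_pos
      (by simp [(hZP _ hs).1]) (by simpa [(hZP _ hs).2.1] using hA0)
    linarith
  have hhigh : 0 ≤ P (B 0 + 1) 1 := by
    have hs := hsub ⟨hle, le_rfl⟩
    have := deriv_neg_of_concave_where_neg (fun x hx ↦ (above _ hs x hx).1)
      (fun x hx ↦ (above _ hs x hx).2.1) (fun x hx ↦ (above _ hs x hx).2.2) le_rfl one_pos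
      (by simp [(hZP _ hs).1]) (by simpa [(hZP _ hs).2.1] using hB0)
    linarith
  obtain ⟨s, hs, hPs⟩ := intermediate_value_Icc hle (hPc.mono hsub) ⟨hlow, hhigh⟩
  have hs := hsub hs
  have hPs : P s 1 = 0 := hPs
  obtain ⟨-, hP0, hd⟩ := hZP s hs
  have hA_le : ∀ x ∈ Icc (0:ℝ) 1, A x ≤ Z s x := fun x hx ↦ sub_nonneg.1 <|
    nonneg_of_concave_where_neg (fun x hx ↦ (below _ hs x hx).1)
      (fun x hx ↦ (below _ hs x hx).2.1) (fun x hx ↦ (below _ hs x hx).2.2)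
      (by simpa [hP0] using hA0) (by simpa [hPs] using hA1) x hx
  have hle_B : ∀ x ∈ Icc (0:ℝ) 1, Z s x ≤ B x := fun x hx ↦ sub_nonneg.1 <|
    nonneg_of_concave_where_neg (fun x hx ↦ (above _ hs x hx).1)
      (fun x hx ↦ (above _ hs x hx).2.1) (fun x hx ↦ (above _ hs x hx).2.2)
      (by simpa [hP0] using hB0) (by simpa [hPs] using hB1) x hx
  refine ⟨Z s, P s, fun x hx ↦ (hd x hx).1, fun x hx ↦ ?_, hP0, hPs,
    fun x hx ↦ ⟨hA_le x hx, hle_B x hx⟩⟩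
  have hcx : c x (Z s x) = Z s x := by
    simp only [c, min_eq_left (hle_B x hx), max_eq_right (hA_le x hx)]
  simpa [F, hcx] using (hd x hx).2

/-- The function `w ↦ w log w`, frozen outside `[m, 1]`, is bounded and Lipschitz. -/
lemma exists_bound_lipschitz_mul_log {m : ℝ} (hm : 0 < m) (hm1 : m ≤ 1) :
    ∃ K : ℝ≥0, (∀ z : ℝ, |max m (min z 1) * Real.log (max m (min z 1))| ≤ K) ∧
      LipschitzWith K fun z : ℝ ↦ max m (min z 1) * Real.log (max m (min z 1)) := by
  have hmem : ∀ z : ℝ, max m (min z 1) ∈ Icc m 1 := fun z ↦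
    ⟨le_max_left _ _, max_le hm1 (min_le_right _ _)⟩
  have hlog : ∀ w ∈ Icc m 1, |Real.log w| ≤ |Real.log m| := fun w hw ↦ by
    rw [abs_of_nonpos (Real.log_nonpos (hm.le.trans hw.1) hw.2),
      abs_of_nonpos (Real.log_nonpos hm.le hm1)]
    exact neg_le_neg (Real.log_le_log hm hw.1)
  let K : ℝ≥0 := ‖Real.log m‖₊ + 1
  have hK : (K : ℝ) = |Real.log m| + 1 := by simp [K]
  refine ⟨K, fun z ↦ ?_, ?_⟩
  · have h := hmem z
    rw [abs_mul, abs_of_pos (hm.trans_le h.1), hK]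
    nlinarith [hlog _ h, abs_nonneg (Real.log (max m (min z 1))), h.2]
  · have h : LipschitzOnWith K (fun w ↦ w * Real.log w) (Icc m 1) := by
      refine (convex_Icc m 1).lipschitzOnWith_of_nnnorm_hasDerivWithin_le
        (fun w hw ↦ (Real.hasDerivAt_mul_log (hm.trans_le hw.1).ne').hasDerivWithinAt)
        fun w hw ↦ ?_
      rw [← NNReal.coe_le_coe, hK, coe_nnnorm, Real.norm_eq_abs]
      refine (abs_add_le _ _).trans ?_
      rw [abs_one]
      linarith [hlog w hw]
    have hc : LipschitzWith 1 fun z : ℝ ↦ max m (min z 1) :=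
      (LipschitzWith.id.min_const 1).const_max m
    simpa [Function.comp_def] using
      lipschitzOnWith_univ.1 (h.comp (lipschitzOnWith_univ.2 hc) fun z _ ↦ hmem z)

lemma hasDerivAt_exp_neg_div {U U' : ℝ → ℝ} {x : ℝ} (ν : ℝ) (h : HasDerivAt U (U' x) x) :
    HasDerivAt (fun x ↦ Real.exp (-U x / (2 * ν)))
      (-U' x / (2 * ν) * Real.exp (-U x / (2 * ν))) x := by
  exact (h.fun_neg.div_const (2 * ν)).exp.congr_deriv (mul_comm _ _)

lemma hasDerivAt_deriv_exp_neg_div {U U' U'' : ℝ → ℝ} {x : ℝ} (ν : ℝ)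
    (h : HasDerivAt U (U' x) x) (h' : HasDerivAt U' (U'' x) x) :
    HasDerivAt (fun x ↦ -U' x / (2 * ν) * Real.exp (-U x / (2 * ν)))
      ((-U'' x / (2 * ν) + (U' x / (2 * ν)) ^ 2) * Real.exp (-U x / (2 * ν))) x := by
  refine ((h'.fun_neg.div_const (2 * ν)).fun_mul (hasDerivAt_exp_neg_div ν h)).congr_deriv ?_
  ring

/-- The method of sub- and supersolutions for `-ν u'' + (1/2)(u')² = a u`. -/
lemma exists_posSol_of_sub_super {ν : ℝ} (hν : 0 < ν) {a : ℝ → ℝ} (ha : ContinuousOn a (Icc 0 1))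
    {U U' U'' W W' W'' : ℝ → ℝ}
    (hU : ∀ x ∈ Icc (0:ℝ) 1, HasDerivAt U (U' x) x)
    (hU' : ∀ x ∈ Icc (0:ℝ) 1, HasDerivAt U' (U'' x) x)
    (hW : ∀ x ∈ Icc (0:ℝ) 1, HasDerivAt W (W' x) x)
    (hW' : ∀ x ∈ Icc (0:ℝ) 1, HasDerivAt W' (W'' x) x)
    (hWpos : ∀ x ∈ Icc (0:ℝ) 1, 0 < W x) (hWU : ∀ x ∈ Icc (0:ℝ) 1, W x ≤ U x)
    (hUsup : ∀ x ∈ Icc (0:ℝ) 1, a x * U x ≤ -ν * U'' x + (1/2) * (U' x) ^ 2)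
    (hWsub : ∀ x ∈ Icc (0:ℝ) 1, -ν * W'' x + (1/2) * (W' x) ^ 2 ≤ a x * W x)
    (hU0 : U' 0 ≤ 0) (hU1 : 0 ≤ U' 1) (hW0 : 0 ≤ W' 0) (hW1 : W' 1 ≤ 0) :
    ∃ u u' u'' : ℝ → ℝ, PosSol ν a u u' u'' := by
  have h2ν : 0 < 2 * ν := by positivity
  have hUc : ContinuousOn U (Icc 0 1) := fun x hx ↦ (hU x hx).continuousAt.continuousWithinAt
  obtain ⟨c, hc, hmax⟩ := isCompact_Icc.exists_isMaxOn (nonempty_Icc.2 zero_le_one) hUc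
  set m := Real.exp (-U c / (2 * ν))
  have hm : 0 < m := Real.exp_pos _
  have hEle : ∀ {s t : ℝ}, s ≤ t → Real.exp (-t / (2 * ν)) ≤ Real.exp (-s / (2 * ν)) :=
    fun h ↦ Real.exp_le_exp.2 (div_le_div_of_nonneg_right (neg_le_neg h) h2ν.le)
  have hElt : ∀ {s : ℝ}, 0 < s → Real.exp (-s / (2 * ν)) < 1 := fun h ↦
    Real.exp_lt_one_iff.2 (div_neg_of_neg_of_pos (neg_neg_of_pos h) h2ν)
  have hmle : ∀ x ∈ Icc (0:ℝ) 1, m ≤ Real.exp (-U x / (2 * ν)) := fun x hx ↦ hEle (hmax hx)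
  have hUpos : ∀ x ∈ Icc (0:ℝ) 1, 0 < U x := fun x hx ↦ (hWpos x hx).trans_le (hWU x hx)
  obtain ⟨K, hKb, hKL⟩ := exists_bound_lipschitz_mul_log hm (hElt (hUpos c hc)).le
  obtain ⟨Q, hQ⟩ := isCompact_Icc.exists_bound_of_continuousOn (ha.neg.div_const ν)
  have hQ0 : 0 ≤ Q := (norm_nonneg _).trans (hQ 0 ⟨le_rfl, zero_le_one⟩)
  lift Q to ℝ≥0 using hQ0
  set g : ℝ → ℝ := fun z ↦ max m (min z 1) * Real.log (max m (min z 1)) with hg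
  have hgexp : ∀ w : ℝ, 0 < w → m ≤ Real.exp (-w / (2 * ν)) →
      g (Real.exp (-w / (2 * ν))) = -w / (2 * ν) * Real.exp (-w / (2 * ν)) := fun w hw hle ↦ by
    simp only [hg, min_eq_left (hElt hw).le, max_eq_right hle, Real.log_exp]
    rw [mul_comm]
  have key : ∀ x s t w E : ℝ, (-s / (2 * ν) + (t / (2 * ν)) ^ 2) * E -
      -a x / ν * (-w / (2 * ν) * E) = (-ν * s + (1/2) * t ^ 2 - a x * w) * (E / (2 * ν ^ 2)) := by
    intro x s t w E
    field_simp
  obtain ⟨z, p, hz, hp, hp0, hp1, hzb⟩ := exists_neumann_solution_between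
    (f := fun t z ↦ -a t / ν * g z) (C := Q * K) (L := Q * K)
    (fun z ↦ (ha.neg.div_const ν).mul continuousOn_const)
    (fun t ht ↦ LipschitzWith.of_dist_le_mul fun z w ↦ by
      rw [Real.dist_eq, ← mul_sub, abs_mul, NNReal.coe_mul, mul_assoc]
      exact mul_le_mul (hQ t ht) (hKL.dist_le_mul z w) (abs_nonneg _) Q.2)
    (fun t ht z ↦ by
      rw [abs_mul, NNReal.coe_mul]
      exact mul_le_mul (hQ t ht) (hKb z) (abs_nonneg _) Q.2)
    (fun x hx ↦ hasDerivAt_exp_neg_div ν (hU x hx))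
    (fun x hx ↦ hasDerivAt_deriv_exp_neg_div ν (hU x hx) (hU' x hx))
    (fun x hx ↦ hasDerivAt_exp_neg_div ν (hW x hx))
    (fun x hx ↦ hasDerivAt_deriv_exp_neg_div ν (hW x hx) (hW' x hx))
    (fun x hx ↦ hEle (hWU x hx))
    (fun x hx ↦ by
      rw [hgexp _ (hUpos x hx) (hmle x hx), ← sub_nonneg, key]
      exact mul_nonneg (sub_nonneg.2 (hUsup x hx)) (by positivity))
    (fun x hx ↦ by
      rw [hgexp _ (hWpos x hx) ((hmle x hx).trans (hEle (hWU x hx))), ← sub_nonpos, key]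
      exact mul_nonpos_of_nonpos_of_nonneg (sub_nonpos.2 (hWsub x hx)) (by positivity))
    (mul_nonneg (div_nonneg (by linarith) h2ν.le) (Real.exp_pos _).le)
    (mul_nonpos_of_nonpos_of_nonneg (div_nonpos_of_nonpos_of_nonneg (by linarith) h2ν.le)
      (Real.exp_pos _).le)
    (mul_nonpos_of_nonpos_of_nonneg (div_nonpos_of_nonpos_of_nonneg (by linarith) h2ν.le)
      (Real.exp_pos _).le)
    (mul_nonneg (div_nonneg (by linarith) h2ν.le) (Real.exp_pos _).le)
  have hmz : ∀ x ∈ Icc (0:ℝ) 1, m ≤ z x := fun x hx ↦ (hmle x hx).trans (hzb x hx).1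
  have hz0 : ∀ x ∈ Icc (0:ℝ) 1, 0 < z x := fun x hx ↦ hm.trans_le (hmz x hx)
  have hz1 : ∀ x ∈ Icc (0:ℝ) 1, z x < 1 := fun x hx ↦
    (hzb x hx).2.trans_lt (hElt (hWpos x hx))
  have hzc : ContinuousOn z (Icc 0 1) := fun x hx ↦ (hz x hx).continuousAt.continuousWithinAt
  have hpc : ContinuousOn p (Icc 0 1) := fun x hx ↦ (hp x hx).continuousAt.continuousWithinAt
  have hzne : ∀ x ∈ Icc (0:ℝ) 1, z x ≠ 0 := fun x hx ↦ (hz0 x hx).ne'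
  refine ⟨fun x ↦ -2 * ν * Real.log (z x), fun x ↦ -2 * ν * (p x / z x),
    fun x ↦ -2 * ν * (-a x / ν * Real.log (z x) - (p x / z x) ^ 2),
    ⟨fun x hx ↦ ((hz x hx).log (hzne x hx)).const_mul _, fun x hx ↦ ?_, ?_⟩, fun x hx ↦ ?_,
    by simp [hp0], by simp [hp1], fun x hx ↦ ?_⟩
  · have h := ((hp x hx).fun_div (hz x hx) (hzne x hx)).const_mul (-2 * ν)
    refine h.congr_deriv ?_
    have hgz : g (z x) = z x * Real.log (z x) := by
      simp only [hg, min_eq_left (hz1 x hx).le, max_eq_right (hmz x hx)]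
    have := hzne x hx
    rw [hgz]
    field_simp
  · exact continuousOn_const.mul (((ha.neg.div_const ν).mul (hzc.log hzne)).sub
      ((hpc.div hzc hzne).pow 2))
  · nlinarith [Real.log_neg (hz0 x hx) (hz1 x hx)]
  · field_simp
    ring

/-- A subsolution: a small multiple of the positive principal eigenfunction. -/
lemma exists_subsolution {ν lam : ℝ} {a φ φ' φ'' : ℝ → ℝ} (hlam : 0 < lam)
    (hφ : C2On01 φ φ' φ'') (hφ_pos : ∀ x ∈ Icc (0:ℝ) 1, 0 < φ x)
    (hφ_eq : ∀ x ∈ Icc (0:ℝ) 1, -ν * φ'' x - a x * φ x = -lam * φ x)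
    {δ : ℝ} (hδ : 0 < δ) :
    ∃ ε > 0, (∀ x ∈ Icc (0:ℝ) 1, ε * φ x ≤ δ) ∧ ∀ x ∈ Icc (0:ℝ) 1,
      -ν * (ε * φ'' x) + (1/2) * (ε * φ' x) ^ 2 ≤ a x * (ε * φ x) := by
  obtain ⟨hd, hd', -⟩ := hφ
  have hc : ContinuousOn φ (Icc 0 1) := fun x hx ↦ (hd x hx).continuousAt.continuousWithinAt
  have hc' : ContinuousOn φ' (Icc 0 1) := fun x hx ↦ (hd' x hx).continuousAt.continuousWithinAt
  obtain ⟨c, hcm, hmin⟩ := isCompact_Icc.exists_isMinOn (nonempty_Icc.2 zero_le_one) hc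
  obtain ⟨M, hM⟩ := isCompact_Icc.exists_bound_of_continuousOn hc
  obtain ⟨N, hN⟩ := isCompact_Icc.exists_bound_of_continuousOn (hc'.pow 2)
  have hM0 : 0 ≤ M := (norm_nonneg _).trans (hM 0 ⟨le_rfl, zero_le_one⟩)
  have hN0 : 0 ≤ N := (norm_nonneg _).trans (hN 0 ⟨le_rfl, zero_le_one⟩)
  have hφc := hφ_pos c hcm
  refine ⟨min (δ / (M + 1)) (2 * lam * φ c / (N + 1)), by positivity, fun x hx ↦ ?_,
    fun x hx ↦ ?_⟩
  · have h1 : φ x ≤ M := (le_abs_self _).trans (hM x hx)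
    calc _ ≤ δ / (M + 1) * (M + 1) :=
          mul_le_mul (min_le_left _ _) (by linarith) (hφ_pos x hx).le (by positivity)
      _ = δ := by field_simp
  · set ε := min (δ / (M + 1)) (2 * lam * φ c / (N + 1))
    have hε : 0 < ε := by positivity
    have h1 : φ' x ^ 2 ≤ N := (le_abs_self _).trans (hN x hx)
    have h2 : ε * φ' x ^ 2 ≤ 2 * lam * φ x := by
      calc _ ≤ 2 * lam * φ c / (N + 1) * (N + 1) :=
            mul_le_mul (min_le_right _ _) (by linarith) (by positivity) (by positivity)
        _ = 2 * lam * φ c := by field_simp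
        _ ≤ _ := mul_le_mul_of_nonneg_left (hmin hx) (by positivity)
    have h3 := hφ_eq x hx
    have h4 : -ν * (ε * φ'' x) + (1/2) * (ε * φ' x) ^ 2 - a x * (ε * φ x) =
        ε * ((1/2) * (ε * φ' x ^ 2) - lam * φ x) := by linear_combination ε * h3
    nlinarith

/-- A supersolution: a large multiple of a parabola centred where `a` is negative. -/
lemma exists_supersolution {ν : ℝ} (hν : 0 < ν) {a : ℝ → ℝ} (ha : ContinuousOn a (Icc 0 1))
    {x₀ : ℝ} (hx₀ : x₀ ∈ Icc (0:ℝ) 1) (hax₀ : a x₀ < 0) :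
    ∃ K > 0, ∃ D > 0, ∀ x ∈ Icc (0:ℝ) 1,
      a x * (K * ((x - x₀) ^ 2 + D)) ≤ -ν * (K * 2) + (1/2) * (K * (2 * (x - x₀))) ^ 2 := by
  obtain ⟨Q, hQ⟩ := isCompact_Icc.exists_bound_of_continuousOn ha
  have hQ0 : 0 ≤ Q := (norm_nonneg _).trans (hQ 0 ⟨le_rfl, zero_le_one⟩)
  obtain ⟨δ, hδ, hδa⟩ := Metric.continuousOn_iff.1 ha x₀ hx₀ (-a x₀ / 2) (by linarith)
  set D := 2 * ν / (-a x₀ / 2)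
  have hη : 0 < -a x₀ / 2 := by linarith
  have hD0 : 0 < D := by positivity
  have hDη : D * (-a x₀ / 2) = 2 * ν := div_mul_cancel₀ _ hη.ne'
  refine ⟨(2 * ν + Q * (1 + D)) / (2 * δ ^ 2), by positivity, D, hD0, fun x hx ↦ ?_⟩
  set K := (2 * ν + Q * (1 + D)) / (2 * δ ^ 2) with hK
  have hK0 : 0 < K := by positivity
  have hKδ : 2 * K * δ ^ 2 = 2 * ν + Q * (1 + D) := by rw [hK]; field_simp
  suffices h : a x * ((x - x₀) ^ 2 + D) ≤ -2 * ν + 2 * K * (x - x₀) ^ 2 by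
    nlinarith [mul_le_mul_of_nonneg_left h hK0.le]
  rcases lt_or_ge |x - x₀| δ with hlt | hge
  · have h1 := hδa x hx hlt
    rw [Real.dist_eq, abs_lt] at h1
    have h2 : a x ≤ -(-a x₀ / 2) := by linarith
    nlinarith [sq_nonneg (x - x₀), mul_nonneg hK0.le (sq_nonneg (x - x₀))]
  · have h1 : δ ^ 2 ≤ (x - x₀) ^ 2 := by
      rw [← sq_abs (x - x₀)]
      exact pow_le_pow_left₀ hδ.le hge 2
    have h2 : (x - x₀) ^ 2 ≤ 1 := by
      rw [sq_le_one_iff_abs_le_one, abs_le]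
      exact ⟨by linarith [hx.1, hx₀.2], by linarith [hx.2, hx₀.1]⟩
    have h3 : a x ≤ Q := (le_abs_self _).trans (hQ x hx)
    have h4 : a x * ((x - x₀) ^ 2 + D) ≤ Q * (1 + D) :=
      mul_le_mul h3 (by linarith) (by positivity) hQ0
    nlinarith

lemma exists_hasDerivAt_of_continuousOn {b : ℝ → ℝ} (hb : ContinuousOn b (Icc 0 1)) :
    ∃ E : ℝ → ℝ, ∀ x ∈ Icc (0:ℝ) 1, HasDerivAt E (b x) x := by
  have hc : Continuous fun t ↦ b (projIcc (0:ℝ) 1 zero_le_one t) :=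
    hb.comp_continuous (continuous_subtype_val.comp continuous_projIcc) fun t ↦
      (projIcc (0:ℝ) 1 zero_le_one t).2
  refine ⟨fun x ↦ ∫ t in (0:ℝ)..x, b (projIcc (0:ℝ) 1 zero_le_one t), fun x hx ↦ ?_⟩
  simpa [projIcc_of_mem _ hx] using hc.integral_hasStrictDerivAt 0 x |>.hasDerivAt

lemma eq_zero_of_hasDerivAt_of_forall_eq {f : ℝ → ℝ} {c d x : ℝ} (hx : x ∈ Icc (0:ℝ) 1)
    (hf : HasDerivAt f d x) (h : ∀ y ∈ Icc (0:ℝ) 1, f y = c) : d = 0 :=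
  (uniqueDiffOn_Icc one_pos x hx).eq_deriv _ hf.hasDerivWithinAt
    ((hasDerivWithinAt_const x _ c).congr h (h x hx))

/-- Uniqueness of the positive Neumann solution when `a` does not vanish identically. -/
lemma PosSol.eq_of_ne_zero {ν : ℝ} (hν : 0 < ν) {a u u' u'' v v' v'' : ℝ → ℝ}
    (hu : PosSol ν a u u' u'') (hv : PosSol ν a v v' v'')
    {x₀ : ℝ} (hx₀ : x₀ ∈ Icc (0:ℝ) 1) (ha : a x₀ ≠ 0) {x : ℝ} (hx : x ∈ Icc (0:ℝ) 1) :
    v x = u x := by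
  obtain ⟨⟨hud, hud', -⟩, hu0, hu'0, hu'1, hue⟩ := hu
  obtain ⟨⟨hvd, hvd', -⟩, hv0, hv'0, hv'1, hve⟩ := hv
  have cont : ∀ {f f' : ℝ → ℝ}, (∀ x ∈ Icc (0:ℝ) 1, HasDerivAt f (f' x) x) →
      ContinuousOn f (Icc 0 1) := fun h x hx ↦ (h x hx).continuousAt.continuousWithinAt
  set p : ℝ → ℝ := fun x ↦ u' x / u x with hp
  set q : ℝ → ℝ := fun x ↦ v' x / v x with hq
  set w : ℝ → ℝ := fun x ↦ Real.log (v x) - Real.log (u x) with hw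
  have hwd : ∀ x ∈ Icc (0:ℝ) 1, HasDerivAt w (q x - p x) x := fun x hx ↦
    ((hvd x hx).log (hv0 x hx).ne').sub ((hud x hx).log (hu0 x hx).ne')
  obtain ⟨E, hE⟩ := exists_hasDerivAt_of_continuousOn
    (b := fun x ↦ (v x / (2 * ν) - 1) * (q x + p x)) <| by
      have h1 := (cont hvd').div (cont hvd) fun x hx ↦ (hv0 x hx).ne'
      have h2 := (cont hud').div (cont hud) fun x hx ↦ (hu0 x hx).ne'
      exact (((cont hvd).div_const _).sub continuousOn_const).mul (h1.add h2)
  have hwd' : ∀ x ∈ Icc (0:ℝ) 1, HasDerivAt (fun x ↦ q x - p x)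
      ((v x / (2 * ν) - 1) * (q x + p x) * (q x - p x) + (v x - u x) * p x ^ 2 / (2 * ν)) x := by
    intro x hx
    have hvx := (hv0 x hx).ne'
    have hux := (hu0 x hx).ne'
    have h := ((hvd' x hx).fun_div (hvd x hx) hvx).fun_sub ((hud' x hx).fun_div (hud x hx) hux)
    refine h.congr_deriv ?_
    have e1 : v'' x = ((1/2) * v' x ^ 2 - a x * v x) / ν := by
      rw [eq_div_iff hν.ne']; linarith [hve x hx]
    have e2 : u'' x = ((1/2) * u' x ^ 2 - a x * u x) / ν := by
      rw [eq_div_iff hν.ne']; linarith [hue x hx]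
    simp only [hp, hq]
    rw [e1, e2]
    field_simp
    ring
  have hmono : ∀ x ∈ Icc (0:ℝ) 1, 0 ≤ w x * (v x - u x) := by
    intro x hx
    rcases le_total (u x) (v x) with h | h
    · exact mul_nonneg (sub_nonneg.2 (Real.log_le_log (hu0 x hx) h)) (sub_nonneg.2 h)
    · exact mul_nonneg_of_nonpos_of_nonpos
        (sub_nonpos.2 (Real.log_le_log (hv0 x hx) h)) (sub_nonpos.2 h)
  set H : ℝ → ℝ := fun x ↦ Real.exp (-E x) * (w x * (q x - p x)) with hH
  set H' : ℝ → ℝ := fun x ↦ Real.exp (-E x) *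
    ((q x - p x) ^ 2 + w x * (v x - u x) * p x ^ 2 / (2 * ν)) with hH'
  have hHd : ∀ x ∈ Icc (0:ℝ) 1, HasDerivAt H (H' x) x := by
    intro x hx
    have h := (hE x hx).fun_neg.exp.fun_mul ((hwd x hx).fun_mul (hwd' x hx))
    refine h.congr_deriv ?_
    simp only [hH']
    ring
  have hpos : ∀ x ∈ Icc (0:ℝ) 1, 0 ≤ w x * (v x - u x) * p x ^ 2 / (2 * ν) := fun x hx ↦
    div_nonneg (mul_nonneg (hmono x hx) (sq_nonneg _)) (by positivity)
  have hHmono : MonotoneOn H (Icc 0 1) := by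
    refine monotoneOn_of_deriv_nonneg (convex_Icc _ _) (cont hHd) (fun x hx ↦ ?_) fun x hx ↦ ?_
    · exact (hHd x (interior_subset hx)).differentiableAt.differentiableWithinAt
    · rw [(hHd x (interior_subset hx)).deriv]
      exact mul_nonneg (Real.exp_pos _).le
        (add_nonneg (sq_nonneg _) (hpos x (interior_subset hx)))
  have m0 : (0:ℝ) ∈ Icc (0:ℝ) 1 := ⟨le_rfl, zero_le_one⟩
  have m1 : (1:ℝ) ∈ Icc (0:ℝ) 1 := ⟨zero_le_one, le_rfl⟩
  have hH0 : H 0 = 0 := by simp [hH, hp, hq, hu'0, hv'0]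
  have hH1 : H 1 = 0 := by simp [hH, hp, hq, hu'1, hv'1]
  have hHzero : ∀ x ∈ Icc (0:ℝ) 1, H x = 0 := fun x hx ↦ le_antisymm
    (hH1 ▸ hHmono hx m1 hx.2) (hH0 ▸ hHmono m0 hx hx.1)
  have hsum : ∀ x ∈ Icc (0:ℝ) 1, (q x - p x) ^ 2 + w x * (v x - u x) * p x ^ 2 / (2 * ν) = 0 :=
    fun x hx ↦ (mul_eq_zero.1 (eq_zero_of_hasDerivAt_of_forall_eq hx (hHd x hx) hHzero)).resolve_left
      (Real.exp_pos _).ne'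
  have hw' : ∀ x ∈ Icc (0:ℝ) 1, q x - p x = 0 := fun x hx ↦
    pow_eq_zero_iff two_ne_zero |>.1 (by nlinarith [hsum x hx, hpos x hx, sq_nonneg (q x - p x)])
  have hwconst : ∀ y ∈ Icc (0:ℝ) 1, w y = w 0 :=
    constant_of_has_deriv_right_zero (cont hwd) fun y hy ↦ by
      have hy' := Ico_subset_Icc_self hy
      simpa only [hw' y hy'] using (hwd y hy').hasDerivWithinAt
  have hw_iff : ∀ y ∈ Icc (0:ℝ) 1, v y = u y ↔ w y = 0 := fun y hy ↦ by
    rw [hw, sub_eq_zero]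
    exact (Real.log_injOn_pos.eq_iff (hv0 y hy) (hu0 y hy)).symm
  by_contra hne
  have hw0 : w 0 ≠ 0 := fun h ↦ hne ((hw_iff x hx).2 ((hwconst x hx).trans h))
  have hu'z : ∀ y ∈ Icc (0:ℝ) 1, u' y = 0 := by
    intro y hy
    have hwy : w y ≠ 0 := by rwa [hwconst y hy]
    have hvu : v y - u y ≠ 0 := sub_ne_zero.2 fun h ↦ hwy ((hw_iff y hy).1 h)
    have h := hsum y hy
    rw [hw' y hy] at h
    have hp0 : p y = 0 := by simpa [hwy, hvu, hν.ne'] using h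
    exact (div_eq_zero_iff.1 hp0).resolve_right (hu0 y hy).ne'
  have hu'' : u'' x₀ = 0 := eq_zero_of_hasDerivAt_of_forall_eq hx₀ (hud' x₀ hx₀) hu'z
  have h := hue x₀ hx₀
  rw [hu'', hu'z x₀ hx₀] at h
  have : a x₀ * u x₀ ≠ 0 := mul_ne_zero ha (hu0 x₀ hx₀).ne'
  exact this (by rw [← h]; ring)

/-- Theorem 3.1 (main theorem): under the spectral assumption `λ₁(-ν Δ - a) < 0` and
`min a < 0`, there is exactly one positive Neumann solution of `-ν u'' + (1/2)(u')² = a u`. -/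
theorem stmt_6 (ν : ℝ) (hν : 0 < ν) (a : ℝ → ℝ)
    (ha_smooth : ContDiffOn ℝ (⊤ : ℕ∞) a (Icc (0:ℝ) 1))
    (lam : ℝ) (hlam : 0 < lam) (φ φ' φ'' : ℝ → ℝ)
    (hφ : C2On01 φ φ' φ'')
    (hφ_pos : ∀ x ∈ Icc (0:ℝ) 1, 0 < φ x)
    (hφ'0 : φ' 0 = 0) (hφ'1 : φ' 1 = 0)
    (hφ_eq : ∀ x ∈ Icc (0:ℝ) 1, -ν * φ'' x - a x * φ x = -lam * φ x)
    (ha_neg : ∃ x₀ ∈ Icc (0:ℝ) 1, a x₀ < 0) :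
    ∃ u u' u'' : ℝ → ℝ, PosSol ν a u u' u'' ∧
      ∀ v v' v'' : ℝ → ℝ, PosSol ν a v v' v'' → ∀ x ∈ Icc (0:ℝ) 1, v x = u x := by
  have ha := ha_smooth.continuousOn
  obtain ⟨x₀, hx₀, hax₀⟩ := ha_neg
  obtain ⟨K, hK, D, hD, hsup⟩ := exists_supersolution hν ha hx₀ hax₀
  obtain ⟨ε, hε, hle, hsub⟩ := exists_subsolution hlam hφ hφ_pos hφ_eq (mul_pos hK hD)
  obtain ⟨u, u', u'', hu⟩ := exists_posSol_of_sub_super hν ha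
    (U := fun x ↦ K * ((x - x₀) ^ 2 + D)) (U' := fun x ↦ K * (2 * (x - x₀)))
    (U'' := fun _ ↦ K * 2)
    (fun x _ ↦ by
      have := ((((hasDerivAt_id' x).sub_const x₀).fun_pow 2).add_const D).const_mul K
      simpa using this)
    (fun x _ ↦ by
      have := (((hasDerivAt_id' x).sub_const x₀).const_mul 2).const_mul K
      simpa using this)
    (fun x hx ↦ (hφ.1 x hx).const_mul ε) (fun x hx ↦ (hφ.2.1 x hx).const_mul ε)
    (fun x hx ↦ mul_pos hε (hφ_pos x hx))
    (fun x hx ↦ (hle x hx).trans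
      (mul_le_mul_of_nonneg_left (le_add_of_nonneg_left (sq_nonneg _)) hK.le))
    hsup hsub
    (mul_nonpos_of_nonneg_of_nonpos hK.le (by linarith [hx₀.1]))
    (mul_nonneg hK.le (by linarith [hx₀.2])) (by simp [hφ'0]) (by simp [hφ'1])
  exact ⟨u, u', u'', hu, fun v v' v'' hv x hx ↦ hu.eq_of_ne_zero hν hv hx₀ hax₀.ne hx⟩
end

section
/- Let ν > 0 and let a : ℝ → ℝ be continuous on [0,1] with a not identically zero on [0,1]. Suppose there exist λ ≥ 0 and a C² function φ with φ(x) > 0 for all x ∈ [0,1], φ'(0) = φ'(1) = 0, and −ν φ''(x) − a(x) φ(x) = λ φ(x) for all x ∈ [0,1]. Then every C² function u on [0,1] with u(x) ≥ 0 for all x ∈ [0,1], u'(0) = u'(1) = 0, and −ν u''(x) + (1/2) u'(x)² = a(x) u(x) for all x ∈ [0,1] is identically zero on [0,1]. -/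
open Set

/-- On `[0,1]`, if `f` is constant then a derivative of `f` vanishes there, endpoints included. -/
theorem eq_zero_of_hasDerivAt_of_eqOn_const {f : ℝ → ℝ} {c d x : ℝ} (hx : x ∈ Icc (0:ℝ) 1)
    (hf : HasDerivAt f d x) (hc : ∀ y ∈ Icc (0:ℝ) 1, f y = c) : d = 0 := by
  have h : HasDerivWithinAt f 0 (Icc (0:ℝ) 1) x :=
    (hasDerivWithinAt_const x (Icc (0:ℝ) 1) c).congr hc (hc x hx)
  exact (uniqueDiffOn_Icc one_pos x hx).eq_deriv _ hf.hasDerivWithinAt h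

/-- A function on `[0,1]` with nonpositive derivative and equal endpoint values has zero
derivative. -/
theorem hasDerivAt_eq_zero_of_nonpos_of_endpoints_eq {f f' : ℝ → ℝ}
    (hf : ∀ x ∈ Icc (0:ℝ) 1, HasDerivAt f (f' x) x)
    (hf' : ∀ x ∈ Icc (0:ℝ) 1, f' x ≤ 0) (h01 : f 0 = f 1) :
    ∀ x ∈ Icc (0:ℝ) 1, f' x = 0 := by
  have hanti : AntitoneOn f (Icc (0:ℝ) 1) := by
    refine antitoneOn_of_hasDerivWithinAt_nonpos (convex_Icc 0 1)
      (fun x hx => (hf x hx).continuousAt.continuousWithinAt)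
      (fun x hx => (hf x (interior_subset hx)).hasDerivWithinAt)
      (fun x hx => hf' x (interior_subset hx))
  have hconst : ∀ y ∈ Icc (0:ℝ) 1, f y = f 0 := fun y hy =>
    le_antisymm (hanti (left_mem_Icc.2 zero_le_one) hy hy.1)
      (h01 ▸ hanti hy (right_mem_Icc.2 zero_le_one) hy.2)
  exact fun x hx => eq_zero_of_hasDerivAt_of_eqOn_const hx (hf x hx) hconst

/-- First necessity proposition of Section 3.2: if `a ≠ 0` and the principal Neumann eigenvalue of
`-ν d²/dx² - a` is nonnegative (witnessed by a positive eigenfunction with eigenvalue `lam ≥ 0`),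
then the only nonnegative Neumann solution of `-ν u'' + (1/2)(u')² = a u` is `0`. -/
theorem stmt_7 (ν : ℝ) (hν : 0 < ν) (a : ℝ → ℝ)
    (ha_cont : ContinuousOn a (Icc (0:ℝ) 1))
    (ha_ne : ∃ x ∈ Icc (0:ℝ) 1, a x ≠ 0)
    (lam : ℝ) (hlam : 0 ≤ lam) (φ φ' φ'' : ℝ → ℝ)
    (hφ : C2On01 φ φ' φ'')
    (hφ_pos : ∀ x ∈ Icc (0:ℝ) 1, 0 < φ x)
    (hφ'0 : φ' 0 = 0) (hφ'1 : φ' 1 = 0)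
    (hφ_eq : ∀ x ∈ Icc (0:ℝ) 1, -ν * φ'' x - a x * φ x = lam * φ x)
    (u u' u'' : ℝ → ℝ) (hu : C2On01 u u' u'')
    (hu_nonneg : ∀ x ∈ Icc (0:ℝ) 1, 0 ≤ u x)
    (hu'0 : u' 0 = 0) (hu'1 : u' 1 = 0)
    (hu_eq : ∀ x ∈ Icc (0:ℝ) 1, -ν * u'' x + (1/2) * (u' x)^2 = a x * u x) :
    ∀ x ∈ Icc (0:ℝ) 1, u x = 0 := by
  obtain ⟨hφ1, hφ2, -⟩ := hφ
  obtain ⟨hu1, hu2, -⟩ := hu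
  -- Differentiate the Wronskian `ν (u φ' - u' φ)`.
  have hW : ∀ x ∈ Icc (0:ℝ) 1, HasDerivAt (fun y => ν * (u y * φ' y - u' y * φ y))
      (-(lam * (u x * φ x)) - 1 / 2 * (u' x) ^ 2 * φ x) x := by
    intro x hx
    refine ((((hu1 x hx).mul (hφ2 x hx)).sub ((hu2 x hx).mul (hφ1 x hx))).const_mul ν).congr_deriv ?_
    linear_combination φ x * hu_eq x hx - u x * hφ_eq x hx
  have hlow : ∀ x ∈ Icc (0:ℝ) 1, 0 ≤ lam * (u x * φ x) := fun x hx =>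
    mul_nonneg hlam (mul_nonneg (hu_nonneg x hx) (hφ_pos x hx).le)
  have hsq : ∀ x ∈ Icc (0:ℝ) 1, 0 ≤ 1 / 2 * (u' x) ^ 2 * φ x := fun x hx =>
    mul_nonneg (by positivity) (hφ_pos x hx).le
  have hW0 := hasDerivAt_eq_zero_of_nonpos_of_endpoints_eq hW
    (fun x hx => by linarith [hlow x hx, hsq x hx]) (by simp [hφ'0, hφ'1, hu'0, hu'1])
  have hu'_zero : ∀ x ∈ Icc (0:ℝ) 1, u' x = 0 := by
    intro x hx
    have h : 1 / 2 * (u' x) ^ 2 * φ x = 0 := by linarith [hW0 x hx, hlow x hx, hsq x hx]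
    simpa [(hφ_pos x hx).ne'] using h
  have hconst : ∀ x ∈ Icc (0:ℝ) 1, u x = u 0 :=
    constant_of_has_deriv_right_zero (fun x hx => (hu1 x hx).continuousAt.continuousWithinAt)
      (fun x hx => by
        have h := (hu1 x (Ico_subset_Icc_self hx)).hasDerivWithinAt (s := Ici x)
        rwa [hu'_zero x (Ico_subset_Icc_self hx)] at h)
  obtain ⟨z, hz, haz⟩ := ha_ne
  have hu''z : u'' z = 0 := eq_zero_of_hasDerivAt_of_eqOn_const hz (hu2 z hz) hu'_zero
  have huz : u z = 0 := by
    have h := hu_eq z hz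
    rw [hu''z, hu'_zero z hz] at h
    simpa [haz] using h.symm
  intro x hx
  rw [hconst x hx, ← hconst z hz, huz]
end

section
/- Let ν > 0 and let a : ℝ → ℝ be continuous on [0,1] with a(x) ≥ 0 for all x ∈ [0,1]. Suppose there exists a C² function u on [0,1] with u(x) > 0 for all x ∈ (0,1), u'(0) = u'(1) = 0, and −ν u''(x) + (1/2) u'(x)² = a(x) u(x) for all x ∈ [0,1]. Then a(x) = 0 for all x ∈ [0,1]. -/
open Set

/-- Second necessity proposition of Section 3.2: if `a ≥ 0` and there is a Neumann solution of
`-ν u'' + (1/2)(u')² = a u` which is positive in the interior, then `a ≡ 0`. -/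
theorem stmt_8 (ν : ℝ) (hν : 0 < ν) (a : ℝ → ℝ)
    (ha_cont : ContinuousOn a (Icc (0:ℝ) 1))
    (ha_nonneg : ∀ x ∈ Icc (0:ℝ) 1, 0 ≤ a x)
    (u u' u'' : ℝ → ℝ) (hu : C2On01 u u' u'')
    (hu_pos : ∀ x ∈ Ioo (0:ℝ) 1, 0 < u x)
    (hu'0 : u' 0 = 0) (hu'1 : u' 1 = 0)
    (hu_eq : ∀ x ∈ Icc (0:ℝ) 1, -ν * u'' x + (1/2) * (u' x)^2 = a x * u x) :
    ∀ x ∈ Icc (0:ℝ) 1, a x = 0 := by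
  obtain ⟨hu1, hu2, -⟩ := hu
  set g : ℝ → ℝ := fun x => u' x * Real.exp (-u x / (2 * ν)) with hg
  have hgd : ∀ x ∈ Icc (0:ℝ) 1,
      HasDerivAt g (-(a x * u x / ν) * Real.exp (-u x / (2 * ν))) x := by
    intro x hx
    have h := (hu2 x hx).mul (((hu1 x hx).neg.div_const (2 * ν)).exp)
    refine h.congr_deriv ?_
    rw [← hu_eq x hx]
    simp only [Pi.neg_apply]
    field_simp
    ring
  have hanti : AntitoneOn g (Icc 0 1) := by
    refine antitoneOn_of_deriv_nonpos (convex_Icc 0 1)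
      (fun x hx => (hgd x hx).continuousAt.continuousWithinAt) ?_ ?_
    · rw [interior_Icc]
      exact fun x hx =>
        (hgd x (Ioo_subset_Icc_self hx)).differentiableAt.differentiableWithinAt
    · rw [interior_Icc]
      intro x hx
      have hx' := Ioo_subset_Icc_self hx
      rw [(hgd x hx').deriv, neg_mul, neg_nonpos]
      have := ha_nonneg x hx'
      have := hu_pos x hx
      positivity
  have hzero : ∀ x ∈ Icc (0:ℝ) 1, g x = 0 := by
    intro x hx
    have h0 := hanti (left_mem_Icc.2 zero_le_one) hx hx.1
    have h1 := hanti hx (right_mem_Icc.2 zero_le_one) hx.2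
    simp only [hg, hu'0, hu'1, zero_mul] at h0 h1 ⊢
    exact le_antisymm h0 h1
  have haint : EqOn a (fun _ => 0) (Ioo 0 1) := by
    intro x hx
    have hev : g =ᶠ[nhds x] fun _ => 0 :=
      Filter.eventually_of_mem (Icc_mem_nhds hx.1 hx.2) hzero
    have h := (hgd x (Ioo_subset_Icc_self hx)).unique
      ((hasDerivAt_const x (0:ℝ)).congr_of_eventuallyEq hev)
    simpa [hν.ne', (hu_pos x hx).ne', Real.exp_ne_zero] using h
  exact haint.of_subset_closure ha_cont continuousOn_const Ioo_subset_Icc_self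
    (closure_Ioo zero_ne_one).ge
end

section
/- Let ν > 0 and let a : ℝ → ℝ be continuous on [0,1] and take both a positive and a negative value on [0,1]. Let f₁, f₂ : ℝ → ℝ be continuous on [0,1] with 0 ≤ f₁(x) ≤ f₂(x) for all x ∈ [0,1]. Suppose u₁ and u₂ are C² functions on [0,1], each bounded below on [0,1] by a positive constant, with u₁'(0) = u₁'(1) = u₂'(0) = u₂'(1) = 0, satisfying −ν u₁''(x) + (1/2) u₁'(x)² = a(x) u₁(x) + f₁(x) and −ν u₂''(x) + (1/2) u₂'(x)² = a(x) u₂(x) + f₂(x) for all x ∈ [0,1]. Then u₁(x) ≤ u₂(x) for all x ∈ [0,1]. -/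
open Set

theorem hasDerivAt_max_zero_sq (t : ℝ) :
    HasDerivAt (fun s : ℝ => max s 0 ^ 2) (2 * max t 0) t := by
  rcases lt_trichotomy t 0 with ht | rfl | ht
  · rw [max_eq_right ht.le, mul_zero]
    refine (hasDerivAt_const t (0 : ℝ)).congr_of_eventuallyEq ?_
    filter_upwards [eventually_lt_nhds ht] with s hs
    simp [max_eq_right hs.le]
  · rw [max_self, mul_zero, hasDerivAt_iff_isLittleO]
    have hsq : (fun s : ℝ => s ^ 2) =o[nhds 0] fun s : ℝ => s := by
      simpa using Asymptotics.isLittleO_pow_pow (𝕜 := ℝ) (m := 1) (n := 2) one_lt_two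
    have hle : (fun s : ℝ => max s 0 ^ 2) =O[nhds 0] fun s : ℝ => s ^ 2 := by
      refine Asymptotics.IsBigO.of_bound 1 (Filter.Eventually.of_forall fun s => ?_)
      rw [one_mul, norm_pow, norm_pow]
      refine pow_le_pow_left₀ (norm_nonneg _) ?_ 2
      rw [Real.norm_of_nonneg (le_max_right s 0), Real.norm_eq_abs]
      exact max_le (le_abs_self s) (abs_nonneg s)
    simpa using hle.trans_isLittleO hsq
  · rw [max_eq_left ht.le]
    have h : HasDerivAt (fun s : ℝ => s ^ 2) (2 * t) t := by simpa using hasDerivAt_pow 2 t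
    refine h.congr_of_eventuallyEq ?_
    filter_upwards [eventually_gt_nhds ht] with s hs
    simp [max_eq_left hs.le]

theorem HasDerivAt.eq_zero_of_eqOn_Icc {f : ℝ → ℝ} {f' x p q : ℝ} (hpq : p < q)
    (hx : x ∈ Icc p q) (hf : HasDerivAt f f' x) (h0 : ∀ y ∈ Icc p q, f y = 0) : f' = 0 :=
  (uniqueDiffOn_Icc hpq x hx).eq_deriv _ hf.hasDerivWithinAt
    ((hasDerivWithinAt_const x (Icc p q) (0 : ℝ)).congr h0 (h0 x hx))

/-- A one-dimensional strong maximum principle with Neumann boundary conditions: if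
`z'' ≥ b z'` wherever `z > 0`, then the positive part of `z` is constant. -/
theorem pos_and_deriv_eq_zero_of_neumann {p q : ℝ} (hpq : p ≤ q) {z z' z'' b : ℝ → ℝ}
    (hz : ∀ x ∈ Icc p q, HasDerivAt z (z' x) x)
    (hz' : ∀ x ∈ Icc p q, HasDerivAt z' (z'' x) x)
    (hb : ContinuousOn b (Icc p q))
    (hineq : ∀ x ∈ Icc p q, 0 < z x → b x * z' x ≤ z'' x)
    (hp : z' p = 0) (hq : z' q = 0) (hpos : ∃ x ∈ Icc p q, 0 < z x) :
    ∀ x ∈ Icc p q, 0 < z x ∧ z' x = 0 := by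
  obtain ⟨y, hy, hzy⟩ := hpos
  have hc : Continuous (IccExtend hpq ((Icc p q).domRestrict b)) :=
    (continuousOn_iff_continuous_domRestrict.mp hb).Icc_extend'
  obtain ⟨B, hB⟩ : ∃ B : ℝ → ℝ, ∀ x ∈ Icc p q, HasDerivAt B (b x) x := by
    refine ⟨fun x => ∫ t in p..x, IccExtend hpq ((Icc p q).domRestrict b) t, fun x hx => ?_⟩
    have h := hc.integral_hasStrictDerivAt p x
    rw [IccExtend_of_mem hpq _ hx] at h
    exact h.hasDerivAt
  have hsq : ∀ x ∈ Icc p q,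
      HasDerivAt (fun s => max (z s) 0 ^ 2) (2 * max (z x) 0 * z' x) x := fun x hx =>
    (hasDerivAt_max_zero_sq (z x)).comp x (hz x hx)
  let φ : ℝ → ℝ := fun x => Real.exp (-B x) * z' x * max (z x) 0 ^ 2
  have hφ : ∀ x ∈ Icc p q, HasDerivAt φ
      (Real.exp (-B x) * ((z'' x - b x * z' x) * max (z x) 0 ^ 2
        + 2 * max (z x) 0 * z' x ^ 2)) x := by
    intro x hx
    refine (((hB x hx).fun_neg.exp.fun_mul (hz' x hx)).fun_mul (hsq x hx)).congr_deriv ?_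
    ring
  have hmono : MonotoneOn φ (Icc p q) := by
    refine monotoneOn_of_hasDerivWithinAt_nonneg (convex_Icc p q)
      (fun x hx => (hφ x hx).continuousAt.continuousWithinAt)
      (fun x hx => (hφ x (interior_subset hx)).hasDerivWithinAt) fun x hx => ?_
    refine mul_nonneg (Real.exp_pos _).le (add_nonneg ?_ (by positivity))
    rcases le_or_gt (z x) 0 with h | h
    · simp [max_eq_right h]
    · exact mul_nonneg (sub_nonneg.mpr (hineq x (interior_subset hx) h)) (sq_nonneg _)
  have hzero : ∀ x ∈ Icc p q, z' x = 0 ∨ max (z x) 0 = 0 := by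
    intro x hx
    have h1 := hmono (left_mem_Icc.mpr hpq) hx hx.1
    have h2 := hmono hx (right_mem_Icc.mpr hpq) hx.2
    simp only [φ, hp, hq, mul_zero, zero_mul] at h1 h2
    simpa [(Real.exp_pos _).ne'] using le_antisymm h2 h1
  have hconst : ∀ x ∈ Icc p q, max (z x) 0 ^ 2 = max (z p) 0 ^ 2 := by
    refine constant_of_derivWithin_zero
      (fun x hx => (hsq x hx).differentiableAt.differentiableWithinAt) fun x hx => ?_
    have hx' := Ico_subset_Icc_self hx
    rw [(hsq x hx').hasDerivWithinAt.derivWithin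
      (uniqueDiffOn_Icc (hx.1.trans_lt hx.2) x hx')]
    rcases hzero x hx' with h | h <;> simp [h]
  intro x hx
  have hzx : 0 < z x := by
    by_contra! h
    have := (hconst x hx).trans (hconst y hy).symm
    rw [max_eq_right h, max_eq_left hzy.le] at this
    exact (pow_pos hzy 2).ne' (by simpa using this.symm)
  refine ⟨hzx, (hzero x hx).resolve_right fun h => ?_⟩
  exact hzx.not_ge (max_eq_right_iff.mp h)

/-- Corollary to Theorem 3.4: the positive Neumann solution of `-ν u'' + (1/2)(u')² = a u + f`
is monotone with respect to the nonnegative source term `f`. -/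
theorem stmt_10 (ν : ℝ) (hν : 0 < ν) (a : ℝ → ℝ)
    (ha_cont : ContinuousOn a (Icc (0:ℝ) 1))
    (ha_pos : ∃ x ∈ Icc (0:ℝ) 1, 0 < a x)
    (ha_neg : ∃ x ∈ Icc (0:ℝ) 1, a x < 0)
    (f₁ f₂ : ℝ → ℝ)
    (hf₁_cont : ContinuousOn f₁ (Icc (0:ℝ) 1)) (hf₂_cont : ContinuousOn f₂ (Icc (0:ℝ) 1))
    (hf₁_nonneg : ∀ x ∈ Icc (0:ℝ) 1, 0 ≤ f₁ x)
    (hf₁₂ : ∀ x ∈ Icc (0:ℝ) 1, f₁ x ≤ f₂ x)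
    (u₁ u₁' u₁'' u₂ u₂' u₂'' : ℝ → ℝ)
    (hu₁ : C2On01 u₁ u₁' u₁'') (hu₂ : C2On01 u₂ u₂' u₂'')
    (δ₁ : ℝ) (hδ₁ : 0 < δ₁) (hu₁δ : ∀ x ∈ Icc (0:ℝ) 1, δ₁ ≤ u₁ x)
    (δ₂ : ℝ) (hδ₂ : 0 < δ₂) (hu₂δ : ∀ x ∈ Icc (0:ℝ) 1, δ₂ ≤ u₂ x)
    (hu₁'0 : u₁' 0 = 0) (hu₁'1 : u₁' 1 = 0) (hu₂'0 : u₂' 0 = 0) (hu₂'1 : u₂' 1 = 0)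
    (heq₁ : ∀ x ∈ Icc (0:ℝ) 1, -ν * u₁'' x + (1/2) * (u₁' x)^2 = a x * u₁ x + f₁ x)
    (heq₂ : ∀ x ∈ Icc (0:ℝ) 1, -ν * u₂'' x + (1/2) * (u₂' x)^2 = a x * u₂ x + f₂ x) :
    ∀ x ∈ Icc (0:ℝ) 1, u₁ x ≤ u₂ x := by
  obtain ⟨hd₁, hdd₁, -⟩ := hu₁
  obtain ⟨hd₂, hdd₂, -⟩ := hu₂
  have hp₁ : ∀ x ∈ Icc (0:ℝ) 1, 0 < u₁ x := fun x hx => hδ₁.trans_le (hu₁δ x hx)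
  have hp₂ : ∀ x ∈ Icc (0:ℝ) 1, 0 < u₂ x := fun x hx => hδ₂.trans_le (hu₂δ x hx)
  have hcont : ∀ {g g' : ℝ → ℝ}, (∀ x ∈ Icc (0:ℝ) 1, HasDerivAt g (g' x) x) →
      ContinuousOn g (Icc (0:ℝ) 1) :=
    fun h x hx => (h x hx).continuousAt.continuousWithinAt
  by_contra! hcon
  obtain ⟨y, hy, hlt⟩ := hcon
  let z : ℝ → ℝ := fun x => Real.log (u₁ x) - Real.log (u₂ x)
  let z' : ℝ → ℝ := fun x => u₁' x / u₁ x - u₂' x / u₂ x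
  let z'' : ℝ → ℝ := fun x => (u₁'' x * u₁ x - u₁' x * u₁' x) / u₁ x ^ 2 -
    (u₂'' x * u₂ x - u₂' x * u₂' x) / u₂ x ^ 2
  let b : ℝ → ℝ := fun x => (u₁ x / 2 - ν) * (u₁' x / u₁ x + u₂' x / u₂ x) / ν
  have hz : ∀ x ∈ Icc (0:ℝ) 1, HasDerivAt z (z' x) x := fun x hx =>
    ((hd₁ x hx).log (hp₁ x hx).ne').sub ((hd₂ x hx).log (hp₂ x hx).ne')
  have hz' : ∀ x ∈ Icc (0:ℝ) 1, HasDerivAt z' (z'' x) x := fun x hx =>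
    ((hdd₁ x hx).div (hd₁ x hx) (hp₁ x hx).ne').sub ((hdd₂ x hx).div (hd₂ x hx) (hp₂ x hx).ne')
  have hb : ContinuousOn b (Icc (0:ℝ) 1) :=
    ((((hcont hd₁).div_const 2).sub continuousOn_const).mul
      (((hcont hdd₁).div (hcont hd₁) fun x hx => (hp₁ x hx).ne').add
        ((hcont hdd₂).div (hcont hd₂) fun x hx => (hp₂ x hx).ne'))).div_const ν
  have hlt_of_pos : ∀ x ∈ Icc (0:ℝ) 1, 0 < z x → u₂ x < u₁ x := fun x hx h =>
    (Real.log_lt_log_iff (hp₂ x hx) (hp₁ x hx)).mp (sub_pos.mp h)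
  have hkey : ∀ x ∈ Icc (0:ℝ) 1, ν * (z'' x - b x * z' x) =
      (u₁ x - u₂ x) / 2 * (u₂' x / u₂ x) ^ 2 + (f₂ x / u₂ x - f₁ x / u₁ x) := by
    intro x hx
    have h₁ := (hp₁ x hx).ne'
    have h₂ := (hp₂ x hx).ne'
    have e₁ : u₁'' x = ((1/2) * u₁' x ^ 2 - a x * u₁ x - f₁ x) / ν := by
      rw [eq_div_iff hν.ne']; linarith [heq₁ x hx]
    have e₂ : u₂'' x = ((1/2) * u₂' x ^ 2 - a x * u₂ x - f₂ x) / ν := by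
      rw [eq_div_iff hν.ne']; linarith [heq₂ x hx]
    simp only [z', z'', b, e₁, e₂]
    field_simp
    ring
  have hsource : ∀ x ∈ Icc (0:ℝ) 1, u₂ x < u₁ x → 0 ≤ f₂ x / u₂ x - f₁ x / u₁ x :=
    fun x hx h => sub_nonneg.mpr
      (div_le_div₀ ((hf₁_nonneg x hx).trans (hf₁₂ x hx)) (hf₁₂ x hx) (hp₂ x hx) h.le)
  have hconst := pos_and_deriv_eq_zero_of_neumann zero_le_one hz hz' hb
    (fun x hx hzx => by
      have h := hlt_of_pos x hx hzx
      refine sub_nonneg.mp (nonneg_of_mul_nonneg_right ?_ hν)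
      rw [hkey x hx]
      exact add_nonneg (mul_nonneg (by linarith) (sq_nonneg _)) (hsource x hx h))
    (by simp [z', hu₁'0, hu₂'0]) (by simp [z', hu₁'1, hu₂'1])
    ⟨y, hy, sub_pos.mpr (Real.log_lt_log (hp₂ y hy) hlt)⟩
  have hu₂' : ∀ x ∈ Icc (0:ℝ) 1, u₂' x = 0 := by
    intro x hx
    have h := hlt_of_pos x hx (hconst x hx).1
    have hk := hkey x hx
    rw [(hz' x hx).eq_zero_of_eqOn_Icc zero_lt_one hx fun t ht => (hconst t ht).2,
      (hconst x hx).2, mul_zero, sub_zero, mul_zero] at hk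
    have hsq : (u₂' x / u₂ x) ^ 2 = 0 := by
      nlinarith [hsource x hx h, sq_nonneg (u₂' x / u₂ x)]
    simpa [(hp₂ x hx).ne'] using hsq
  obtain ⟨x, hx, hax⟩ := ha_pos
  have h := heq₂ x hx
  rw [hu₂' x hx, (hdd₂ x hx).eq_zero_of_eqOn_Icc zero_lt_one hx hu₂'] at h
  nlinarith [mul_pos hax (hp₂ x hx), hf₁_nonneg x hx, hf₁₂ x hx]
end

section
/- Let ν > 0 and let a : ℝ → ℝ be continuous on [0,1] and take both a positive and a negative value on [0,1]. For λ > 0, call u_λ a λ-solution if u_λ is C² on [0,1], u_λ(x) > 0 for all x ∈ [0,1], u_λ'(0) = u_λ'(1) = 0, and −ν u_λ''(x) + λ·(1/2) u_λ'(x)² = a(x) u_λ(x) for all x ∈ [0,1]. Then: (i) for any λ, μ > 0 and any λ-solution u_λ and μ-solution u_μ, one has λ·u_λ(x) = μ·u_μ(x) for all x ∈ [0,1]; (ii) consequently, if 0 < λ < μ then u_μ(x) < u_λ(x) for all x ∈ [0,1]; and (iii) for each fixed x ∈ [0,1], if u₁ is a 1-solution then u_λ(x) = u₁(x)/λ, so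 u_λ(x) → +∞ as λ → 0⁺ and u_λ(x) → 0 as λ → +∞. -/
open Set Filter Topology

/-- `u` is a positive Neumann solution of `-ν u'' + lam (1/2)(u')² = a u` on `[0,1]`
(a `lam`-solution). -/
def LamSol (ν lam : ℝ) (a u u' u'' : ℝ → ℝ) : Prop :=
  C2On01 u u' u'' ∧ (∀ x ∈ Icc (0:ℝ) 1, 0 < u x) ∧ u' 0 = 0 ∧ u' 1 = 0 ∧
  ∀ x ∈ Icc (0:ℝ) 1, -ν * u'' x + lam * ((1/2) * (u' x)^2) = a x * u x

/-- A `lam`-solution multiplied by `lam` is a `1`-solution. -/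
lemma LamSol.const_mul {ν lam : ℝ} {a u u' u'' : ℝ → ℝ} (hlam : 0 < lam)
    (h : LamSol ν lam a u u' u'') :
    LamSol ν 1 a (fun x => lam * u x) (fun x => lam * u' x) (fun x => lam * u'' x) := by
  obtain ⟨⟨h1, h2, h3⟩, hpos, h0, h1', heq⟩ := h
  refine ⟨⟨fun x hx => (h1 x hx).const_mul lam, fun x hx => (h2 x hx).const_mul lam,
    h3.const_mul lam⟩, fun x hx => mul_pos hlam (hpos x hx), by simp [h0], by simp [h1'],
    fun x hx => ?_⟩
  linear_combination lam * heq x hx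

/-- A continuous function on `[0,1]` has an integrating factor. -/
lemma exists_integrating_factor {B : ℝ → ℝ} (hB : ContinuousOn B (Icc (0:ℝ) 1)) :
    ∃ E : ℝ → ℝ, ∀ x ∈ Icc (0:ℝ) 1, 0 < E x ∧ HasDerivAt E (-B x * E x) x := by
  set G : ℝ → ℝ := IccExtend (zero_le_one' ℝ) (domRestrict (Icc (0:ℝ) 1) B) with hG
  have hGc : Continuous G := hB.domRestrict.Icc_extend'
  refine ⟨fun x => Real.exp (-∫ t in (0:ℝ)..x, G t), fun x hx => ⟨Real.exp_pos _, ?_⟩⟩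
  have hGx : G x = B x := by rw [hG, IccExtend_of_mem _ _ hx]; rfl
  have hint := (hGc.integral_hasStrictDerivAt 0 x).hasDerivAt
  rw [hGx] at hint
  exact hint.neg.exp.congr_deriv (mul_comm _ _)

/-- A differentiable function which vanishes on `[0,1]` has zero derivative there. -/
lemma hasDerivAt_eq_zero_of_eq_zero_on {f : ℝ → ℝ} {f' x : ℝ}
    (hf : ∀ y ∈ Icc (0:ℝ) 1, f y = 0) (hx : x ∈ Icc (0:ℝ) 1) (h : HasDerivAt f f' x) :
    f' = 0 :=
  (uniqueDiffOn_Icc (zero_lt_one' ℝ) x hx).eq_deriv _ h.hasDerivWithinAt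
    ((hasDerivWithinAt_const x (Icc (0:ℝ) 1) (0:ℝ)).congr hf (hf x hx))

/-- A function with nonnegative derivative on `[0,1]` vanishing at both endpoints has zero
derivative on `[0,1]`. -/
lemma deriv_eq_zero_of_nonneg_of_endpoints {F F' : ℝ → ℝ}
    (hF : ∀ x ∈ Icc (0:ℝ) 1, HasDerivAt F (F' x) x) (hF' : ∀ x ∈ Icc (0:ℝ) 1, 0 ≤ F' x)
    (h0 : F 0 = 0) (h1 : F 1 = 0) : ∀ x ∈ Icc (0:ℝ) 1, F' x = 0 := by
  have hmono : MonotoneOn F (Icc 0 1) :=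
    monotoneOn_of_hasDerivWithinAt_nonneg (convex_Icc 0 1)
      (fun x hx => (hF x hx).continuousAt.continuousWithinAt)
      (fun x hx => (hF x (interior_subset hx)).hasDerivWithinAt)
      (fun x hx => hF' x (interior_subset hx))
  have hz : ∀ y ∈ Icc (0:ℝ) 1, F y = 0 := fun y hy => le_antisymm
    (h1 ▸ hmono hy (right_mem_Icc.2 zero_le_one) hy.2)
    (h0 ▸ hmono (left_mem_Icc.2 zero_le_one) hy hy.1)
  exact fun x hx => hasDerivAt_eq_zero_of_eq_zero_on hz hx (hF x hx)

/-- Positive Neumann solutions are unique when `a` does not vanish identically. -/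
lemma LamSol.unique {ν : ℝ} (hν : 0 < ν) {a v v' v'' w w' w'' : ℝ → ℝ}
    (ha : ∃ x ∈ Icc (0:ℝ) 1, 0 < a x)
    (hv : LamSol ν 1 a v v' v'') (hw : LamSol ν 1 a w w' w'') :
    ∀ x ∈ Icc (0:ℝ) 1, v x = w x := by
  obtain ⟨⟨hv1, hv2, -⟩, hvpos, hv0, hve, hveq⟩ := hv
  obtain ⟨⟨hw1, hw2, -⟩, hwpos, hw0, hwe, hweq⟩ := hw
  have cv : ContinuousOn v (Icc 0 1) := HasDerivAt.continuousOn hv1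
  have cv' : ContinuousOn v' (Icc 0 1) := HasDerivAt.continuousOn hv2
  have cw : ContinuousOn w (Icc 0 1) := HasDerivAt.continuousOn hw1
  have cw' : ContinuousOn w' (Icc 0 1) := HasDerivAt.continuousOn hw2
  obtain ⟨E, hE⟩ := exists_integrating_factor
    (B := fun x => (v x / 2 - ν) * (v' x / v x + w' x / w x) / ν)
    ((((cv.div_const 2).sub continuousOn_const).mul
      ((cv'.div cv fun x hx => (hvpos x hx).ne').add
        (cw'.div cw fun x hx => (hwpos x hx).ne'))).div_const ν)
  have hkey := deriv_eq_zero_of_nonneg_of_endpoints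
    (F := fun x => E x * (v' x / v x - w' x / w x) * (v x / w x - 1))
    (F' := fun x => E x * ((v x - w x) ^ 2 * (w' x / w x) ^ 2 / (2 * ν * w x)
      + v x / w x * (v' x / v x - w' x / w x) ^ 2))
    (by
      intro x hx
      obtain ⟨-, hEx⟩ := hE x hx
      have hvx := (hvpos x hx).ne'
      have hwx := (hwpos x hx).ne'
      have hV : v'' x = ((1 / 2) * v' x ^ 2 - a x * v x) / ν := by
        rw [eq_div_iff hν.ne']; linear_combination -hveq x hx
      have hW : w'' x = ((1 / 2) * w' x ^ 2 - a x * w x) / ν := by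
        rw [eq_div_iff hν.ne']; linear_combination -hweq x hx
      refine ((hEx.mul (((hv2 x hx).div (hv1 x hx) hvx).sub
        ((hw2 x hx).div (hw1 x hx) hwx))).mul
        (((hv1 x hx).div (hw1 x hx) hwx).sub_const 1)).congr_deriv ?_
      simp only [Pi.mul_apply, Pi.sub_apply, Pi.div_apply]
      rw [hV, hW]
      field_simp
      ring)
    (by
      intro x hx
      have hEx := (hE x hx).1
      have hvx := hvpos x hx
      have hwx := hwpos x hx
      positivity)
    (by simp [hv0, hw0]) (by simp [hve, hwe])
  have hzero : ∀ x ∈ Icc (0:ℝ) 1,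
      v' x / v x - w' x / w x = 0 ∧ (v x = w x ∨ w' x = 0) := by
    intro x hx
    have hvx := hvpos x hx
    have hwx := hwpos x hx
    have hsum := (mul_eq_zero.1 (hkey x hx)).resolve_left (hE x hx).1.ne'
    rw [add_eq_zero_iff_of_nonneg (by positivity) (by positivity)] at hsum
    obtain ⟨h1, h2⟩ := hsum
    refine ⟨by simpa [hvx.ne', hwx.ne'] using h2, ?_⟩
    simpa [hvx.ne', hwx.ne', hν.ne', sub_eq_zero] using h1
  have hratio : ∀ x ∈ Icc (0:ℝ) 1, v x / w x = v 0 / w 0 := by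
    refine constant_of_has_deriv_right_zero
      (cv.div cw fun x hx => (hwpos x hx).ne') fun x hx => ?_
    have hx' : x ∈ Icc (0:ℝ) 1 := Ico_subset_Icc_self hx
    have hvx := (hvpos x hx').ne'
    have hwx := (hwpos x hx').ne'
    refine (((hv1 x hx').div (hw1 x hx') hwx).congr_deriv ?_).hasDerivWithinAt
    have h := (hzero x hx').1
    field_simp at h ⊢
    linear_combination h
  by_cases h0 : v 0 = w 0
  · intro x hx
    have h := hratio x hx
    rwa [h0, div_self (hwpos 0 (left_mem_Icc.2 zero_le_one)).ne',
      div_eq_one_iff_eq (hwpos x hx).ne'] at h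
  · exfalso
    have hw'z : ∀ x ∈ Icc (0:ℝ) 1, w' x = 0 := by
      intro x hx
      refine (hzero x hx).2.resolve_left fun h => h0 ?_
      have hr := hratio x hx
      rw [h, div_self (hwpos x hx).ne'] at hr
      exact (div_eq_one_iff_eq (hwpos 0 (left_mem_Icc.2 zero_le_one)).ne').1 hr.symm
    obtain ⟨x, hx, hax⟩ := ha
    have hw''z := hasDerivAt_eq_zero_of_eq_zero_on hw'z hx (hw2 x hx)
    have h := hweq x hx
    rw [hw''z, hw'z x hx] at h
    have := mul_pos hax (hwpos x hx)
    linarith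

/-- Proposition 3.6: the scaling identity `lam • u_lam = mu • u_mu`, the strict monotonicity of
`lam ↦ u_lam`, and the behaviour `u_lam = u₁ / lam`, which blows up as `lam → 0⁺` and vanishes
as `lam → ∞`. -/
theorem stmt_11 (ν : ℝ) (hν : 0 < ν) (a : ℝ → ℝ)
    (ha_cont : ContinuousOn a (Icc (0:ℝ) 1))
    (ha_pos : ∃ x ∈ Icc (0:ℝ) 1, 0 < a x)
    (ha_neg : ∃ x ∈ Icc (0:ℝ) 1, a x < 0) :
    -- (i) scaling/uniqueness identity
    (∀ lam mu : ℝ, 0 < lam → 0 < mu →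
      ∀ ul ul' ul'' um um' um'' : ℝ → ℝ,
        LamSol ν lam a ul ul' ul'' → LamSol ν mu a um um' um'' →
        ∀ x ∈ Icc (0:ℝ) 1, lam * ul x = mu * um x) ∧
    -- (ii) strict monotonicity in lam
    (∀ lam mu : ℝ, 0 < lam → lam < mu →
      ∀ ul ul' ul'' um um' um'' : ℝ → ℝ,
        LamSol ν lam a ul ul' ul'' → LamSol ν mu a um um' um'' →
        ∀ x ∈ Icc (0:ℝ) 1, um x < ul x) ∧
    -- (iii) u_lam = u₁ / lam and the limits lam → 0⁺, lam → ∞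
    (∀ lam : ℝ, 0 < lam →
      ∀ ul ul' ul'' u₁ u₁' u₁'' : ℝ → ℝ,
        LamSol ν lam a ul ul' ul'' → LamSol ν 1 a u₁ u₁' u₁'' →
        ∀ x ∈ Icc (0:ℝ) 1, ul x = u₁ x / lam ∧
          Tendsto (fun t : ℝ => u₁ x / t) (𝓝[>] 0) atTop ∧
          Tendsto (fun t : ℝ => u₁ x / t) atTop (𝓝 0)) := by
  have key : ∀ lam mu : ℝ, 0 < lam → 0 < mu →
      ∀ ul ul' ul'' um um' um'' : ℝ → ℝ,
        LamSol ν lam a ul ul' ul'' → LamSol ν mu a um um' um'' →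
        ∀ x ∈ Icc (0:ℝ) 1, lam * ul x = mu * um x :=
    fun lam mu hl hm ul ul' ul'' um um' um'' h1 h2 =>
      LamSol.unique hν ha_pos (h1.const_mul hl) (h2.const_mul hm)
  refine ⟨key, ?_, ?_⟩
  · intro lam mu hl hlm ul ul' ul'' um um' um'' h1 h2 x hx
    have h := key lam mu hl (hl.trans hlm) ul ul' ul'' um um' um'' h1 h2 x hx
    have hpos := h2.2.1 x hx
    refine lt_of_mul_lt_mul_left ?_ hl.le
    rw [h]
    exact mul_lt_mul_of_pos_right hlm hpos
  · intro lam hl ul ul' ul'' u₁ u₁' u₁'' h1 h2 x hx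
    refine ⟨?_, ?_, tendsto_const_nhds.div_atTop tendsto_id⟩
    · rw [eq_div_iff hl.ne']
      linear_combination key lam 1 hl one_pos ul ul' ul'' u₁ u₁' u₁'' h1 h2 x hx
    · simpa only [div_eq_mul_inv] using
        tendsto_inv_nhdsGT_zero.const_mul_atTop (h2.2.1 x hx)
end

section
/- Let ν > 0 and let a : ℝ → ℝ be smooth on [0,1]. Assume: (i) there exist λ > 0 and a C² function φ with φ(x) > 0 for all x ∈ [0,1], φ'(0) = φ'(1) = 0, and −ν φ''(x) − a(x) φ(x) = −λ φ(x) for all x ∈ [0,1]; (ii) there exists x₀ ∈ [0,1] with a(x₀) < 0; and (iii) a is non-decreasing on [0,1]. Let u be a C² function on [0,1] with u(x) > 0 for all x ∈ [0,1], u'(0) = u'(1) = 0, and −ν u''(x) + (1/2) u'(x)² = a(x) u(x) for all x ∈ [0,1]. Then u is non-decreasing on [0,1]: for all x ≤ y in [0,1], u(x) ≤ u(y). -/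
open Set

/-- Proposition 3.8 (Proposition 5 of the paper): on `Ω = (0,1)`, if `a` is non-decreasing then
so is the unique positive Neumann solution of `-ν u'' + (1/2)(u')² = a u`. -/
theorem stmt_13 (ν : ℝ) (hν : 0 < ν) (a : ℝ → ℝ)
    (ha_smooth : ContDiffOn ℝ (⊤ : ℕ∞) a (Icc (0:ℝ) 1))
    (lam : ℝ) (hlam : 0 < lam) (φ φ' φ'' : ℝ → ℝ)
    (hφ : C2On01 φ φ' φ'')
    (hφ_pos : ∀ x ∈ Icc (0:ℝ) 1, 0 < φ x)
    (hφ'0 : φ' 0 = 0) (hφ'1 : φ' 1 = 0)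
    (hφ_eq : ∀ x ∈ Icc (0:ℝ) 1, -ν * φ'' x - a x * φ x = -lam * φ x)
    (ha_neg : ∃ x₀ ∈ Icc (0:ℝ) 1, a x₀ < 0)
    (ha_mono : MonotoneOn a (Icc (0:ℝ) 1))
    (u u' u'' : ℝ → ℝ) (hu : C2On01 u u' u'')
    (hu_pos : ∀ x ∈ Icc (0:ℝ) 1, 0 < u x)
    (hu'0 : u' 0 = 0) (hu'1 : u' 1 = 0)
    (hu_eq : ∀ x ∈ Icc (0:ℝ) 1, -ν * u'' x + (1/2) * (u' x)^2 = a x * u x) :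
    ∀ x ∈ Icc (0:ℝ) 1, ∀ y ∈ Icc (0:ℝ) 1, x ≤ y → u x ≤ u y := by
  have hderiv : ∀ x ∈ Icc (0:ℝ) 1, HasDerivAt (fun t => u' t * Real.exp (-u t / (2 * ν)))
      (-(a x * u x / ν) * Real.exp (-u x / (2 * ν))) x := by
    intro x hx
    have hexp := (((hu.1 x hx).neg).div_const (2 * ν)).exp
    refine ((hu.2.1 x hx).mul hexp).congr_deriv ?_
    have hu'' : u'' x = ((1/2) * (u' x)^2 - a x * u x) / ν := by
      rw [eq_div_iff hν.ne']
      linarith [hu_eq x hx]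
    simp only [hu'', Pi.neg_apply]
    field_simp
    ring
  have hu'_nonneg : ∀ x ∈ Icc (0:ℝ) 1, 0 ≤ u' x := by
    intro x hx
    refine nonneg_of_mul_nonneg_left ?_ (Real.exp_pos (-u x / (2 * ν)))
    rcases le_total (a x) 0 with hax | hax
    · have hsub : Icc 0 x ⊆ Icc (0:ℝ) 1 := Icc_subset_Icc_right hx.2
      have hmono : MonotoneOn (fun t => u' t * Real.exp (-u t / (2 * ν))) (Icc 0 x) := by
        refine monotoneOn_of_hasDerivWithinAt_nonneg (convex_Icc 0 x)
          (fun t ht => (hderiv t (hsub ht)).continuousAt.continuousWithinAt)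
          (fun t ht => (hderiv t (hsub (interior_subset ht))).hasDerivWithinAt) fun t ht => ?_
        have ht' := interior_subset ht
        have hat : a t ≤ 0 := (ha_mono (hsub ht') hx ht'.2).trans hax
        exact mul_nonneg (neg_nonneg.2 (div_nonpos_of_nonpos_of_nonneg
          (mul_nonpos_of_nonpos_of_nonneg hat (hu_pos t (hsub ht')).le) hν.le)) (Real.exp_pos _).le
      simpa [hu'0] using hmono (left_mem_Icc.2 hx.1) (right_mem_Icc.2 hx.1) hx.1
    · have hsub : Icc x 1 ⊆ Icc (0:ℝ) 1 := Icc_subset_Icc_left hx.1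
      have hanti : AntitoneOn (fun t => u' t * Real.exp (-u t / (2 * ν))) (Icc x 1) := by
        refine antitoneOn_of_hasDerivWithinAt_nonpos (convex_Icc x 1)
          (fun t ht => (hderiv t (hsub ht)).continuousAt.continuousWithinAt)
          (fun t ht => (hderiv t (hsub (interior_subset ht))).hasDerivWithinAt) fun t ht => ?_
        have ht' := interior_subset ht
        have hat : 0 ≤ a t := hax.trans (ha_mono hx (hsub ht') ht'.1)
        exact mul_nonpos_of_nonpos_of_nonneg (neg_nonpos.2
          (div_nonneg (mul_nonneg hat (hu_pos t (hsub ht')).le) hν.le)) (Real.exp_pos _).le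
      simpa [hu'1] using hanti (left_mem_Icc.2 hx.2) (right_mem_Icc.2 hx.2) hx.2
  exact monotoneOn_of_hasDerivWithinAt_nonneg (convex_Icc 0 1)
    (fun t ht => (hu.1 t ht).continuousAt.continuousWithinAt)
    (fun t ht => (hu.1 t (interior_subset ht)).hasDerivWithinAt)
    fun t ht => hu'_nonneg t (interior_subset ht)
end

section
/- Let ν > 0, ε > 0, and let r : ℝ → ℝ be smooth on [0,1] with r(x) ≥ 0 for all x ∈ [0,1]. Let 0 < λ < λ'. Suppose u and v are C² functions on [0,1], each bounded below on [0,1] by a positive constant, with u'(0) = u'(1) = v'(0) = v'(1) = 0, satisfying −ν u''(x) + ε u'(x)² + u(x) = λ r(x) u(x) and −ν v''(x) + ε v'(x)² + v(x) = λ' r(x) v(x) for all x ∈ [0,1], and assume u(x) ≤ v(x) for all x ∈ [0,1]. Then max over [0,1] of u is strictly smaller than max over [0,1] of v. -/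
open Set

/-- One-sided Grönwall inequality with explicit integrating factor `exp (-g)`: if `f' ≤ g' f` and
`f` vanishes at `x₀`, then `f` is nonpositive to the right of `x₀` and nonnegative to its left. -/
theorem sign_of_deriv_le_mul {a b x₀ : ℝ} {f f' g g' : ℝ → ℝ}
    (hf : ∀ x ∈ Icc a b, HasDerivAt f (f' x) x) (hg : ∀ x ∈ Icc a b, HasDerivAt g (g' x) x)
    (hle : ∀ x ∈ Ioo a b, f' x ≤ g' x * f x) (hx₀ : x₀ ∈ Icc a b) (hzero : f x₀ = 0)
    {x : ℝ} (hx : x ∈ Icc a b) :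
    (x₀ ≤ x → f x ≤ 0) ∧ (x ≤ x₀ → 0 ≤ f x) := by
  have hd : ∀ y ∈ Icc a b, HasDerivAt (fun y => f y * Real.exp (-g y))
      (f' y * Real.exp (-g y) + f y * (Real.exp (-g y) * -g' y)) y :=
    fun y hy => (hf y hy).mul (hg y hy).neg.exp
  have hanti : AntitoneOn (fun y => f y * Real.exp (-g y)) (Icc a b) := by
    refine antitoneOn_of_deriv_nonpos (convex_Icc a b)
      (fun y hy => (hd y hy).continuousAt.continuousWithinAt)
      (fun y hy => (hd y (interior_subset hy)).differentiableAt.differentiableWithinAt) ?_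
    intro y hy
    rw [(hd y (interior_subset hy)).deriv]
    rw [interior_Icc] at hy
    have := mul_nonneg (sub_nonneg.2 (hle y hy)) (Real.exp_pos (-g y)).le
    linarith
  constructor
  · intro h
    have := hanti hx₀ hx h
    simp only [hzero, zero_mul] at this
    exact nonpos_of_mul_nonpos_left this (Real.exp_pos _)
  · intro h
    have := hanti hx hx₀ h
    simp only [hzero, zero_mul] at this
    exact nonneg_of_mul_nonneg_left this (Real.exp_pos _)

/-- Strong maximum principle: a nonnegative supersolution `w'' ≤ β' w' + k w` on `[a, b]` that
vanishes at a point together with its derivative is identically zero. -/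
theorem eq_zero_of_second_deriv_le_s14 {a b x₀ k : ℝ} {w w' w'' β β' : ℝ → ℝ}
    (hw : ∀ x ∈ Icc a b, HasDerivAt w (w' x) x) (hw' : ∀ x ∈ Icc a b, HasDerivAt w' (w'' x) x)
    (hβ : ∀ x ∈ Icc a b, HasDerivAt β (β' x) x) (hβ' : ContinuousOn β' (Icc a b))
    (hnonneg : ∀ x ∈ Icc a b, 0 ≤ w x)
    (hle : ∀ x ∈ Icc a b, w'' x ≤ β' x * w' x + k * w x)
    (hx₀ : x₀ ∈ Icc a b) (hzero : w x₀ = 0) (hzero' : w' x₀ = 0)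
    {x : ℝ} (hx : x ∈ Icc a b) : w x = 0 := by
  obtain ⟨C, hC⟩ := isCompact_Icc.exists_bound_of_continuousOn hβ'
  obtain ⟨m, hm1, hm2, hm3⟩ : ∃ m : ℝ, 0 ≤ m ∧ 1 ≤ m - C ∧ k ≤ m :=
    ⟨max 0 (max (C + 1) k), le_max_left _ _,
      by linarith [(le_max_left (C + 1) k).trans (le_max_right 0 _)],
      (le_max_right (C + 1) k).trans (le_max_right 0 _)⟩
  have hquad : ∀ s, |s| ≤ C → m * s - m ^ 2 + k ≤ 0 := fun s hs => by
    nlinarith [mul_le_mul_of_nonneg_left ((le_abs_self s).trans hs) hm1,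
      mul_le_mul_of_nonneg_left hm2 hm1]
  have hid : ∀ c y : ℝ, HasDerivAt (fun y => c * y) c y := fun c y => by
    simpa using (hasDerivAt_id y).const_mul c
  have hright : ∀ y ∈ Icc a b, x₀ ≤ y → w' y - m * w y ≤ 0 := fun y hy =>
    (sign_of_deriv_le_mul (f := fun y => w' y - m * w y) (g := fun y => β y - m * y)
      (fun y hy => (hw' y hy).sub ((hw y hy).const_mul m))
      (fun y hy => (hβ y hy).sub (hid m y))
      (fun y hy => by
        have hy := Ioo_subset_Icc_self hy
        nlinarith [hle y hy, mul_nonneg (hnonneg y hy) (neg_nonneg.2 (hquad _ (hC y hy)))])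
      hx₀ (by simp [hzero, hzero']) hy).1
  have hleft : ∀ y ∈ Icc a b, y ≤ x₀ → 0 ≤ w' y + m * w y := fun y hy =>
    (sign_of_deriv_le_mul (f := fun y => w' y + m * w y) (g := fun y => β y + m * y)
      (fun y hy => (hw' y hy).add ((hw y hy).const_mul m))
      (fun y hy => (hβ y hy).add (hid m y))
      (fun y hy => by
        have hy := Ioo_subset_Icc_self hy
        have hb : |-β' y| ≤ C := by rw [abs_neg]; exact hC y hy
        nlinarith [hle y hy, mul_nonneg (hnonneg y hy) (neg_nonneg.2 (hquad _ hb))])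
      hx₀ (by simp [hzero, hzero']) hy).2
  refine le_antisymm ?_ (hnonneg x hx)
  rcases le_total x₀ x with h | h
  · refine (sign_of_deriv_le_mul (a := x₀) (b := b) (g := fun y => m * y)
      (fun y hy => hw y ⟨hx₀.1.trans hy.1, hy.2⟩) (fun y _ => hid m y) (fun y hy => ?_)
      ⟨le_rfl, hx₀.2⟩ hzero ⟨h, hx.2⟩).1 h
    linarith [hright y ⟨hx₀.1.trans hy.1.le, hy.2.le⟩ hy.1.le]
  · have := (sign_of_deriv_le_mul (a := a) (b := x₀) (f := fun y => -w y) (g := fun y => -m * y)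
      (fun y hy => (hw y ⟨hy.1, hy.2.trans hx₀.2⟩).neg) (fun y _ => hid (-m) y) (fun y hy => ?_)
      ⟨hx₀.1, le_rfl⟩ (by simp [hzero]) ⟨hx.1, h⟩).2 h
    · linarith
    · linarith [hleft y ⟨hy.1.le, hy.2.le.trans hx₀.2⟩ hy.2.le]

/-- A function vanishing on `[a, b]` has vanishing derivative at interior points. -/
theorem hasDerivAt_eq_zero_of_eqOn {a b d x : ℝ} {f : ℝ → ℝ} (hf : ∀ y ∈ Ioo a b, f y = 0)
    (hx : x ∈ Ioo a b) (hd : HasDerivAt f d x) : d = 0 := by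
  have h : f =ᶠ[nhds x] fun _ => (0 : ℝ) := by
    filter_upwards [isOpen_Ioo.mem_nhds hx] with y hy using hf y hy
  exact hd.unique ((hasDerivAt_const x (0 : ℝ)).congr_of_eventuallyEq h)

/-- Lemma of Section 3.6: along the branch of positive Neumann solutions of
`-ν u'' + ε (u')² + u = lam r u`, the sup norm is strictly increasing in `lam`. -/
theorem stmt_14 (ν ε : ℝ) (hν : 0 < ν) (hε : 0 < ε) (r : ℝ → ℝ)
    (hr_smooth : ContDiffOn ℝ (⊤ : ℕ∞) r (Icc (0:ℝ) 1))
    (hr_nonneg : ∀ x ∈ Icc (0:ℝ) 1, 0 ≤ r x)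
    (lam lam' : ℝ) (hlam : 0 < lam) (hlamlt : lam < lam')
    (u u' u'' v v' v'' : ℝ → ℝ)
    (hu : C2On01 u u' u'') (hv : C2On01 v v' v'')
    (δu : ℝ) (hδu : 0 < δu) (huδ : ∀ x ∈ Icc (0:ℝ) 1, δu ≤ u x)
    (δv : ℝ) (hδv : 0 < δv) (hvδ : ∀ x ∈ Icc (0:ℝ) 1, δv ≤ v x)
    (hu'0 : u' 0 = 0) (hu'1 : u' 1 = 0) (hv'0 : v' 0 = 0) (hv'1 : v' 1 = 0)
    (hu_eq : ∀ x ∈ Icc (0:ℝ) 1, -ν * u'' x + ε * (u' x)^2 + u x = lam * r x * u x)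
    (hv_eq : ∀ x ∈ Icc (0:ℝ) 1, -ν * v'' x + ε * (v' x)^2 + v x = lam' * r x * v x)
    (huv : ∀ x ∈ Icc (0:ℝ) 1, u x ≤ v x) :
    sSup (u '' Icc (0:ℝ) 1) < sSup (v '' Icc (0:ℝ) 1) := by
  obtain ⟨hu1, hu2, -⟩ := hu
  obtain ⟨hv1, hv2, -⟩ := hv
  have hne : (Icc (0:ℝ) 1).Nonempty := ⟨0, by simp⟩
  have huc : ContinuousOn u (Icc 0 1) := fun x hx => (hu1 x hx).continuousAt.continuousWithinAt
  have hvc : ContinuousOn v (Icc 0 1) := fun x hx => (hv1 x hx).continuousAt.continuousWithinAt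
  obtain ⟨x₀, hx₀, hmax, -⟩ := isCompact_Icc.exists_sSup_image_eq_and_ge hne huc
  have hvle : ∀ x ∈ Icc (0:ℝ) 1, v x ≤ sSup (v '' Icc (0:ℝ) 1) := fun x hx =>
    le_csSup (isCompact_Icc.image_of_continuousOn hvc).bddAbove (mem_image_of_mem v hx)
  by_contra! hcon
  have hw0 : v x₀ - u x₀ = 0 := by linarith [hvle x₀ hx₀, huv x₀ hx₀]
  have hwnn : ∀ x ∈ Icc (0:ℝ) 1, 0 ≤ v x - u x := fun x hx => sub_nonneg.2 (huv x hx)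
  have hw1 : ∀ x ∈ Icc (0:ℝ) 1, HasDerivAt (fun x => v x - u x) (v' x - u' x) x :=
    fun x hx => (hv1 x hx).sub (hu1 x hx)
  have hw2 : ∀ x ∈ Icc (0:ℝ) 1, HasDerivAt (fun x => v' x - u' x) (v'' x - u'' x) x :=
    fun x hx => (hv2 x hx).sub (hu2 x hx)
  have hw0' : v' x₀ - u' x₀ = 0 := by
    rcases hx₀.1.eq_or_lt with h | h
    · rw [← h, hu'0, hv'0, sub_zero]
    rcases hx₀.2.eq_or_lt with h' | h'
    · rw [h', hu'1, hv'1, sub_zero]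
    refine IsLocalMin.hasDerivAt_eq_zero (f := fun x => v x - u x) ?_ (hw1 x₀ hx₀)
    filter_upwards [Icc_mem_nhds h h'] with y hy
    rw [hw0]
    exact hwnn y hy
  have hw : ∀ x ∈ Icc (0:ℝ) 1, v x - u x = 0 := fun x hx =>
    eq_zero_of_second_deriv_le_s14 (k := 1 / ν) (w := fun x => v x - u x)
      (β := fun x => ε / ν * (u x + v x)) (β' := fun x => ε / ν * (u' x + v' x)) hw1 hw2
      (fun x hx => ((hu1 x hx).add (hv1 x hx)).const_mul _)
      (fun x hx => (((hu2 x hx).continuousAt.add (hv2 x hx).continuousAt).const_mul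
        (ε / ν)).continuousWithinAt)
      hwnn
      (fun x hx => by
        have h1 : 0 ≤ lam * (r x * (v x - u x)) :=
          mul_nonneg hlam.le (mul_nonneg (hr_nonneg x hx) (hwnn x hx))
        have h2 : 0 ≤ (lam' - lam) * (r x * v x) :=
          mul_nonneg (sub_nonneg.2 hlamlt.le)
            (mul_nonneg (hr_nonneg x hx) (hδv.le.trans (hvδ x hx)))
        have h3 : ε / ν * (u' x + v' x) * (v' x - u' x) + 1 / ν * (v x - u x)
            = (ε * (u' x + v' x) * (v' x - u' x) + (v x - u x)) / ν := by ring
        rw [h3, le_div_iff₀ hν]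
        linarith [hu_eq x hx, hv_eq x hx])
      hx₀ hw0 hw0' hx
  have hw' : ∀ x ∈ Ioo (0:ℝ) 1, v' x - u' x = 0 := fun x hx =>
    hasDerivAt_eq_zero_of_eqOn (fun y hy => hw y (Ioo_subset_Icc_self hy)) hx
      (hw1 x (Ioo_subset_Icc_self hx))
  have hw'' : ∀ x ∈ Ioo (0:ℝ) 1, v'' x - u'' x = 0 := fun x hx =>
    hasDerivAt_eq_zero_of_eqOn hw' hx (hw2 x (Ioo_subset_Icc_self hx))
  have hr : ∀ x ∈ Ioo (0:ℝ) 1, r x = 0 := by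
    intro x hx
    have hx' := Ioo_subset_Icc_self hx
    have e := hv_eq x hx'
    rw [sub_eq_zero.1 (hw x hx'), sub_eq_zero.1 (hw' x hx), sub_eq_zero.1 (hw'' x hx),
      hu_eq x hx'] at e
    have hup : u x ≠ 0 := (hδu.trans_le (huδ x hx')).ne'
    have e' : (lam' - lam) * (r x * u x) = 0 := by linarith
    simpa [sub_ne_zero.2 hlamlt.ne', hup] using e'
  have hu' : ∀ x ∈ Ioo (0:ℝ) 1, u' x = 0 := by
    intro x hx
    have hx' := Ioo_subset_Icc_self hx
    have key : ∀ x₁ ∈ Icc (0:ℝ) 1, u' x₁ = 0 → (x₁ ≤ x → -u' x ≤ 0) ∧ (x ≤ x₁ → 0 ≤ -u' x) :=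
      fun x₁ hx₁ h₁ => sign_of_deriv_le_mul (f := fun y => -u' y) (g := fun y => ε / ν * u y)
        (fun y hy => (hu2 y hy).neg) (fun y hy => (hu1 y hy).const_mul _)
        (fun y hy => by
          have hy' := Ioo_subset_Icc_self hy
          have e := hu_eq y hy'
          rw [hr y hy] at e
          have h3 : ε / ν * u' y * -u' y = -(ε * u' y ^ 2) / ν := by ring
          rw [h3, le_div_iff₀ hν]
          linarith [huδ y hy'])
        hx₁ (by simp [h₁]) hx'
    have h0 := (key 0 (by simp) hu'0).1 hx'.1
    have h1 := (key 1 (by simp) hu'1).2 hx'.2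
    linarith
  have hmid : (1 / 2 : ℝ) ∈ Ioo (0:ℝ) 1 := by norm_num
  have hmid' := Ioo_subset_Icc_self hmid
  have e := hu_eq _ hmid'
  rw [hr _ hmid, hu' _ hmid, hasDerivAt_eq_zero_of_eqOn hu' hmid (hu2 _ hmid')] at e
  linarith [huδ _ hmid']
end
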